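/- arXiv:1808.08421 — 4 statements merged into one kernel-verified Lean document; each statement's English description precedes it below -/
import Mathlib

section
/- For every p⃗₀ ∈ (0,1)^s with Σ_{i≤s}(p₀)_i < 1 there exist δ > 0, α > 0, n ∈ ℕ and constants 0 < c < 1 and C > 0 such that for every p⃗ ∈ B(p⃗₀,δ) (with Σ_{i≤s} p_i < 1) and every h ∈ C^α(ℝ̄): |M_p⃗ⁿh(x) − M_p⃗ⁿh(y)| ≤ (c‖h‖_α + C‖h‖_∞)·d(x,y)^α for all x, y ∈ ℝ̄. -/
open MeasureTheory Filter Topology Set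

noncomputable section

/-- The symbol space `Σ = I^ℕ` with `I = {1, …, s+1}` (coded as `Fin (s+1)`). -/
abbrev Word (s : ℕ) := ℕ → Fin (s + 1)

/-- Multi-indices `ℕ₀^s`. -/
abbrev MI (s : ℕ) := Fin s → ℕ

/-- Extension of a self-map of `ℝ` to the two-point compactification `ℝ̄ = EReal`,
fixing `±∞`. -/
def extE (f : ℝ → ℝ) (x : EReal) : EReal :=
  if x = ⊥ then ⊥ else if x = ⊤ then ⊤ else ((f x.toReal : ℝ) : EReal)

/-- The shift map `σ` on the symbol space. -/
def shiftW {s : ℕ} (ω : Word s) : Word s := fun n => ω (n + 1)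

/-- `μ` is the `(p 0, …, p s)`-Bernoulli measure on the symbol space. -/
def IsBernoulli {s : ℕ} (p : Fin (s + 1) → ℝ) (μ : Measure (Word s)) : Prop :=
  IsProbabilityMeasure μ ∧
    ∀ (n : ℕ) (w : Fin n → Fin (s + 1)),
      μ {ω : Word s | ∀ k : Fin n, ω (k : ℕ) = w k} = ENNReal.ofReal (∏ k, p (w k))

/-- The probability parameters `p⃗ ∈ (0,1)^s` with `∑_{i ≤ s} p i < 1`. -/
def ProbVec {s : ℕ} (p : Fin s → ℝ) : Prop :=
  (∀ i, 0 < p i ∧ p i < 1) ∧ ∑ i, p i < 1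

/-- The full probability vector `(p_1, …, p_s, p_{s+1})` with `p_{s+1} = 1 - ∑_{i≤s} p_i`. -/
def pfull {s : ℕ} (p : Fin s → ℝ) : Fin (s + 1) → ℝ := fun i =>
  if h : (i : ℕ) < s then p ⟨i, h⟩ else 1 - ∑ j, p j

/-- The setting of the paper: a family `f_1, …, f_{s+1}` of expanding `C^{1+ε}`
diffeomorphisms of `ℝ` without a common fixed point, extended to `ℝ̄` (with the metric `d`
strongly equivalent to the Euclidean metric on compact subsets of `ℝ`), contracting near
infinity; together with, for each probability vector, the corresponding Bernoulli measure
on the symbol space. -/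
structure RDS (s : ℕ) where
  hs : 1 ≤ s
  f : Fin (s + 1) → ℝ → ℝ
  eps : ℝ
  heps : 0 < eps
  smooth : ∀ i, ContDiff ℝ 1 (f i)
  derivHolder : ∀ i, ∃ C : ℝ, ∀ x y : ℝ, |deriv (f i) x - deriv (f i) y| ≤ C * |x - y| ^ eps
  bij : ∀ i, Function.Bijective (f i)
  lam : ℝ
  hlam : 1 < lam
  expanding : ∀ i x, lam ≤ deriv (f i) x
  noCommonFix : ¬ ∃ x : ℝ, ∀ i, f i x = x
  d : EReal → EReal → ℝ
  d_comm : ∀ x y, d x y = d y x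
  d_eq_zero : ∀ x y, d x y = 0 ↔ x = y
  d_triangle : ∀ x y z, d x z ≤ d x y + d y z
  d_top : ∀ u : Set EReal, IsOpen u ↔ ∀ x ∈ u, ∃ δ > 0, ∀ y, d x y < δ → y ∈ u
  d_equiv : ∀ K : Set ℝ, IsCompact K → ∃ C > 0, ∀ x ∈ K, ∀ y ∈ K,
      C⁻¹ * |x - y| ≤ d (x : EReal) (y : EReal) ∧ d (x : EReal) (y : EReal) ≤ C * |x - y|
  Vp : Set EReal
  Vm : Set EReal
  hVp : Vp ∈ nhds (⊤ : EReal)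
  hVm : Vm ∈ nhds (⊥ : EReal)
  contracting : ∀ i, ∃ c : ℝ, c < 1 ∧
      (∀ x ∈ Vp, ∀ y ∈ Vp, d (extE (f i) x) (extE (f i) y) ≤ c * d x y) ∧
      (∀ x ∈ Vm, ∀ y ∈ Vm, d (extE (f i) x) (extE (f i) y) ≤ c * d x y)
  bern : (Fin (s + 1) → ℝ) → Measure (Word s)
  bern_spec : ∀ p : Fin (s + 1) → ℝ, (∀ i, 0 < p i) → ∑ i, p i = 1 → IsBernoulli p (bern p)

namespace RDS

variable {s : ℕ}

/-- `V = V⁺ ∪ V⁻`, the neighbourhood of `±∞`. -/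
def V (S : RDS s) : Set EReal := S.Vp ∪ S.Vm

/-- `f_{ω|n} = f_{ω_n} ∘ ⋯ ∘ f_{ω_1}` on `ℝ̄`. -/
def itE (S : RDS s) (ω : Word s) : ℕ → EReal → EReal
  | 0 => id
  | n + 1 => fun x => extE (S.f (ω n)) (itE S ω n x)

/-- `f_{ω|n} = f_{ω_n} ∘ ⋯ ∘ f_{ω_1}` on `ℝ`. -/
def itR (S : RDS s) (ω : Word s) : ℕ → ℝ → ℝ
  | 0 => id
  | n + 1 => fun x => S.f (ω n) (itR S ω n x)

/-- `f_w` for a finite word `w` (first letter applied first). -/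
def applyWord (S : RDS s) : List (Fin (s + 1)) → EReal → EReal
  | [], x => x
  | i :: w, x => applyWord S w (extE (S.f i) x)

/-- The probability of tending to `+∞`, with respect to a given measure `μ` on the
symbol space. -/
def TfunOf (S : RDS s) (μ : Measure (Word s)) (x : EReal) : ℝ :=
  (μ {ω : Word s | Tendsto (fun n => itE S ω n x) atTop (nhds (⊤ : EReal))}).toReal

/-- `T_p⃗`, the probability of tending to `+∞`. -/
def Tfun (S : RDS s) (p : Fin (s + 1) → ℝ) : EReal → ℝ :=
  TfunOf S (S.bern p)

/-- `J_ω = ⋂_n (f_{ω|n})⁻¹(ℝ̄ ∖ V)`. -/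
def codingSet (S : RDS s) (ω : Word s) : Set EReal :=
  ⋂ n : ℕ, (itE S ω (n + 1)) ⁻¹' (V S)ᶜ

/-- The coding map `π : Σ → J`, characterised by `{π(ω)} = ⋂_n (f_{ω|n})⁻¹(ℝ̄ ∖ V)`. -/
def cmap (S : RDS s) (ω : Word s) : EReal := sInf (codingSet S ω)

/-- The coding map, viewed as a map into `ℝ`. -/
def cmapR (S : RDS s) (ω : Word s) : ℝ := (cmap S ω).toReal

/-- The distribution function `F(x) = (μ ∘ π⁻¹)((-∞, x])`. -/
def Fdist (S : RDS s) (μ : Measure (Word s)) (x : EReal) : ℝ :=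
  (μ {ω : Word s | cmap S ω ≤ x}).toReal

/-- Membership in `C^α(ℝ̄)`: `α`-Hölder continuity with respect to `d`. -/
def MemHolder (S : RDS s) (α : ℝ) (h : EReal → ℝ) : Prop :=
  ∃ K : ℝ, ∀ x y, |h x - h y| ≤ K * S.d x y ^ α

/-- Complex-valued version of `MemHolder`. -/
def MemHolderC (S : RDS s) (α : ℝ) (h : EReal → ℂ) : Prop :=
  ∃ K : ℝ, ∀ x y, ‖h x - h y‖ ≤ K * S.d x y ^ α

/-- The supremum norm `‖h‖_∞`. -/
def supN (h : EReal → ℝ) : ℝ := ⨆ x : EReal, |h x|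

/-- The supremum norm `‖h‖_∞`, complex-valued version. -/
def supNC (h : EReal → ℂ) : ℝ := ⨆ x : EReal, ‖h x‖

/-- The Hölder seminorm `V_α(h)`. -/
def hSemi (S : RDS s) (α : ℝ) (h : EReal → ℝ) : ℝ :=
  sInf {K : ℝ | 0 ≤ K ∧ ∀ x y, |h x - h y| ≤ K * S.d x y ^ α}

/-- The `α`-Hölder norm `‖h‖_α = V_α(h) + ‖h‖_∞`. -/
def hNorm (S : RDS s) (α : ℝ) (h : EReal → ℝ) : ℝ := hSemi S α h + supN h

/-- The Hölder seminorm, complex-valued version. -/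
def hSemiC (S : RDS s) (α : ℝ) (h : EReal → ℂ) : ℝ :=
  sInf {K : ℝ | 0 ≤ K ∧ ∀ x y, ‖h x - h y‖ ≤ K * S.d x y ^ α}

/-- The `α`-Hölder norm, complex-valued version. -/
def hNormC (S : RDS s) (α : ℝ) (h : EReal → ℂ) : ℝ := hSemiC S α h + supNC h

/-- The transition operator `M_p⃗ h = ∑_i p_i · (h ∘ f_i)`. -/
def Mop (S : RDS s) (p : Fin (s + 1) → ℝ) (h : EReal → ℝ) : EReal → ℝ :=
  fun x => ∑ i, p i * h (extE (S.f i) x)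

/-- The complexified transition operator. -/
def MopC (S : RDS s) (p : Fin (s + 1) → ℝ) (h : EReal → ℂ) : EReal → ℂ :=
  fun x => ∑ i, (p i : ℂ) * h (extE (S.f i) x)

/-- A bounded linear operator of the Banach space `C^α(ℝ̄)` (complexified). -/
def IsBddOpC (S : RDS s) (α : ℝ) (T : (EReal → ℂ) → EReal → ℂ) : Prop :=
  (∀ g h : EReal → ℂ, T (g + h) = T g + T h) ∧
  (∀ (c : ℂ) (h : EReal → ℂ), T (c • h) = c • T h) ∧
  (∀ h, MemHolderC S α h → MemHolderC S α (T h)) ∧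
  (∃ K : ℝ, ∀ h, MemHolderC S α h → hNormC S α (T h) ≤ K * hNormC S α h)

/-- Bounded invertibility of an operator on `C^α(ℝ̄)`. -/
def InvOnHolder (S : RDS s) (α : ℝ) (T : (EReal → ℂ) → EReal → ℂ) : Prop :=
  ∃ Tinv : (EReal → ℂ) → EReal → ℂ, IsBddOpC S α Tinv ∧
    (∀ h, MemHolderC S α h → Tinv (T h) = h) ∧
    (∀ h, MemHolderC S α h → T (Tinv h) = h)

/-- `z` belongs to the spectrum of `T` acting on `C^α(ℝ̄)`. -/
def SpecMem (S : RDS s) (α : ℝ) (T : (EReal → ℂ) → EReal → ℂ) (z : ℂ) : Prop :=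
  ¬ InvOnHolder S α (fun h => z • h - T h)

/-- `z` is an eigenvalue of `T` on `C^α(ℝ̄)`. -/
def IsEigenC (S : RDS s) (α : ℝ) (T : (EReal → ℂ) → EReal → ℂ) (z : ℂ) : Prop :=
  ∃ h : EReal → ℂ, MemHolderC S α h ∧ h ≠ 0 ∧ T h = z • h

/-- The spectral gap property for an operator on `C^α(ℝ̄)`: the spectrum consists of
finitely many eigenvalues of modulus one, and the rest of the spectrum is contained in
a ball of radius strictly less than one. -/
def HasSpectralGap (S : RDS s) (α : ℝ) (T : (EReal → ℂ) → EReal → ℂ) : Prop :=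
  IsBddOpC S α T ∧
  ∃ (E : Finset ℂ) (r : ℝ), 0 ≤ r ∧ r < 1 ∧
    (∀ z ∈ E, ‖z‖ = 1 ∧ IsEigenC S α T z ∧ SpecMem S α T z) ∧
    (∀ z : ℂ, SpecMem S α T z → z ∈ E ∨ ‖z‖ ≤ r)

/-- Unconditional summability with respect to the `α`-Hölder norm. -/
def HolderHasSum (S : RDS s) (α : ℝ) (g : MI s → EReal → ℝ) (h : EReal → ℝ) : Prop :=
  ∀ ε > 0, ∃ F₀ : Finset (MI s), ∀ F : Finset (MI s), F₀ ⊆ F →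
    hNorm S α (fun x => (∑ n ∈ F, g n x) - h x) < ε

/-- Real-analyticity of a family `p⃗ ↦ T_p⃗ ∈ C^α(ℝ̄)` on a set `U ⊂ ℝ^s`: local
expansion in a power series converging in the `α`-Hölder norm. -/
def AnalyticFamilyHolder (S : RDS s) (α : ℝ) (U : Set (Fin s → ℝ))
    (T : (Fin s → ℝ) → EReal → ℝ) : Prop :=
  ∀ q ∈ U, ∃ r > 0, ∃ c : MI s → EReal → ℝ,
    ∀ p : Fin s → ℝ, p ∈ U → (∀ i, |p i - q i| < r) →
      HolderHasSum S α (fun n x => (∏ i, (p i - q i) ^ n i) * c n x) (T p)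

/-- Equicontinuity (w.r.t. `d`) of the semigroup `G = ⟨f_1, …, f_{s+1}⟩` on a set `U`. -/
def EquicontG (S : RDS s) (U : Set EReal) : Prop :=
  ∀ x ∈ U, ∀ ε > 0, ∃ δ > 0, ∀ y ∈ U, S.d x y < δ →
    ∀ w : List (Fin (s + 1)), w ≠ [] → S.d (applyWord S w x) (applyWord S w y) < ε

/-- The Julia set of the semigroup `G = ⟨f_1, …, f_{s+1}⟩`. -/
def Julia (S : RDS s) : Set EReal := {x | ¬ ∃ U ∈ nhds x, EquicontG S U}

/-- The Julia set, viewed inside `ℝ`. -/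
def JuliaR (S : RDS s) : Set ℝ := {x : ℝ | (x : EReal) ∈ Julia S}

/-- The potential `φ(ω) = -log |f'_{ω_1}(π(ω))|`. -/
def phi (S : RDS s) (ω : Word s) : ℝ := - Real.log |deriv (S.f (ω 0)) (cmapR S ω)|

/-- The potential `ψ_p⃗(ω) = log p_{ω_1}`. -/
def psiP {s : ℕ} (p : Fin (s + 1) → ℝ) (ω : Word s) : ℝ := Real.log (p (ω 0))

/-- The Birkhoff sum `S_n u = ∑_{k<n} u ∘ σ^k`. -/
def birk {s : ℕ} (u : Word s → ℝ) (n : ℕ) (ω : Word s) : ℝ :=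
  ∑ k ∈ Finset.range n, u (fun m => ω (m + k))

/-- `α_-(p⃗) = inf_ω liminf_n S_n ψ_p⃗(ω) / S_n φ(ω)`, the bottom of the spectrum. -/
def alphaMinus (S : RDS s) (p : Fin (s + 1) → ℝ) : ℝ :=
  ⨅ ω : Word s, Filter.liminf (fun n => birk (psiP p) n ω / birk (phi S) n ω) atTop

/-- `α_+(p⃗) = sup_ω limsup_n S_n ψ_p⃗(ω) / S_n φ(ω)`. -/
def alphaPlus (S : RDS s) (p : Fin (s + 1) → ℝ) : ℝ :=
  ⨆ ω : Word s, Filter.limsup (fun n => birk (psiP p) n ω / birk (phi S) n ω) atTop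

/-- `O` witnesses the open set condition. -/
def IsOSCWitness (S : RDS s) (O : Set ℝ) : Prop :=
  (∃ a b : ℝ, a < b ∧ O = Set.Ioo a b) ∧
  (∀ i, S.f i ⁻¹' O ⊆ O) ∧
  (∀ i j, i ≠ j → S.f i ⁻¹' O ∩ S.f j ⁻¹' O = ∅)

/-- The open set condition. -/
def OSC (S : RDS s) : Prop := ∃ O, IsOSCWitness S O

/-- `O` witnesses the separating condition. -/
def IsSepWitness (S : RDS s) (O : Set ℝ) : Prop :=
  (∃ a b : ℝ, a < b ∧ O = Set.Ioo a b) ∧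
  (∀ i, S.f i ⁻¹' O ⊆ O) ∧
  (∀ i j, i ≠ j → S.f i ⁻¹' (closure O) ∩ S.f j ⁻¹' (closure O) = ∅)

/-- The separating condition. -/
def Sep (S : RDS s) : Prop := ∃ O, IsSepWitness S O

/-- Partial derivative in the `i`-th coordinate. -/
def pderiv1 {s : ℕ} (i : Fin s) (F : (Fin s → ℝ) → ℝ) : (Fin s → ℝ) → ℝ :=
  fun u => deriv (fun t : ℝ => F (Function.update u i t)) (u i)

/-- Iterated partial derivative `∂^{n_1}_{u_1} ⋯ ∂^{n_s}_{u_s}`. -/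
def iterPD {s : ℕ} (n : MI s) (F : (Fin s → ℝ) → ℝ) : (Fin s → ℝ) → ℝ :=
  (List.finRange s).foldl (fun G i => (pderiv1 i)^[n i] G) F

/-- `T` as a function of the `s` free parameters `u ∈ ℝ^s`. -/
def Tpar (S : RDS s) (u : Fin s → ℝ) (x : EReal) : ℝ := Tfun S (pfull u) x

/-- The generalised Takagi function
`C_n⃗ = ∂^{n_1}_{u_1} ⋯ ∂^{n_s}_{u_s} T_(u)(x) |_{u = p⃗}`. -/
def Cgen (S : RDS s) (p : Fin s → ℝ) (n : MI s) (x : EReal) : ℝ :=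
  iterPD n (fun u => Tpar S u x) p

/-- Membership in the vector space `𝒯` of generalised Takagi functions. -/
def memT (S : RDS s) (p : Fin s → ℝ) (C : EReal → ℝ) : Prop :=
  ∃ (F : Finset (MI s)) (β : MI s → ℝ), ∀ x, C x = ∑ n ∈ F, β n * Cgen S p n x

/-- `C` is a non-trivial element of `𝒯`. -/
def nontrivT (S : RDS s) (p : Fin s → ℝ) (C : EReal → ℝ) : Prop :=
  ∃ (F : Finset (MI s)) (β : MI s → ℝ), (∃ n ∈ F, β n ≠ 0) ∧
    ∀ x, C x = ∑ n ∈ F, β n * Cgen S p n x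

/-- The set of Hölder exponents at `x`. -/
def HolSet (C : EReal → ℝ) (x : ℝ) : Set ℝ :=
  {α : ℝ | 0 < α ∧ ∃ M : ℝ, ∀ᶠ y : ℝ in nhdsWithin x {x}ᶜ,
      |C (y : EReal) - C (x : EReal)| ≤ M * |y - x| ^ α}

/-- The pointwise Hölder exponent
`Hol(C, x) = sup {α > 0 ∣ limsup_{y → x} |C(y) - C(x)|/|y-x|^α < ∞} ∈ [0, ∞]`. -/
def Hol (C : EReal → ℝ) (x : ℝ) : EReal :=
  sSup (insert (0 : EReal) ((fun a : ℝ => (a : EReal)) '' HolSet C x))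

/-- The topological pressure of a potential `u` for the full shift `(Σ, σ)`. -/
def pressure (S : RDS s) (u : Word s → ℝ) : ℝ :=
  Filter.limsup (fun n : ℕ => (n : ℝ)⁻¹ * Real.log (∑ w : Fin n → Fin (s + 1),
      Real.exp (⨆ ω : {ω : Word s // ∀ k : Fin n, ω (k : ℕ) = w k}, birk u n ω.1))) atTop

/-- The convex conjugate (Legendre transform) `t*(u) = sup_β (βu - t(β))`. -/
def tstar (t : ℝ → ℝ) (u : ℝ) : ℝ := sSup {v : ℝ | ∃ β : ℝ, v = β * u - t β}

/-- The cylinder `[ω|n]`. -/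
def cyl {s : ℕ} (ω : Word s) (n : ℕ) : Set (Word s) := {τ : Word s | ∀ k < n, τ k = ω k}

/-- `μ` is a (shift-invariant) Gibbs probability measure for the potential `u`. -/
def IsGibbs (S : RDS s) (u : Word s → ℝ) (μ : Measure (Word s)) : Prop :=
  IsProbabilityMeasure μ ∧
  (∀ A : Set (Word s), MeasurableSet A → μ (shiftW ⁻¹' A) = μ A) ∧
  ∃ c : ℝ, 0 < c ∧ ∀ (ω : Word s) (n : ℕ),
    ENNReal.ofReal (c⁻¹ * Real.exp (birk u n ω - n * pressure S u)) ≤ μ (cyl ω n) ∧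
    μ (cyl ω n) ≤ ENNReal.ofReal (c * Real.exp (birk u n ω - n * pressure S u))

/-- `x - e⃗_j` for a multi-index `x`. -/
def elemSub {s : ℕ} (x : MI s) (j : Fin s) : MI s := fun k => if k = j then x k - 1 else x k

/-- The one-step matrix `A₀(ω, 1)` of the matrix cocycle. -/
def A1 {s : ℕ} (p : Fin (s + 1) → ℝ) (i : Fin (s + 1)) : MI s → MI s → ℝ := fun x y =>
  (if y = x then p i else 0) +
  (if h : (i : ℕ) < s then
      (if x ⟨(i : ℕ), h⟩ ≠ 0 ∧ y = elemSub x ⟨(i : ℕ), h⟩ then ((x ⟨(i : ℕ), h⟩ : ℕ) : ℝ) else 0)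
    else - ∑ j : Fin s, (if x j ≠ 0 ∧ y = elemSub x j then ((x j : ℕ) : ℝ) else 0))

/-- The matrix cocycle `A₀(ω, k) = A₀(ω,1) A₀(σω,1) ⋯ A₀(σ^{k-1}ω,1)`. -/
def A0 {s : ℕ} (p : Fin (s + 1) → ℝ) : Word s → ℕ → MI s → MI s → ℝ
  | _, 0 => fun x y => if x = y then 1 else 0
  | ω, n + 1 => fun x y => ∑' k : MI s, A1 p (ω 0) x k * A0 p (shiftW ω) n k y

/-- The vector `U(a,b) = (C_n⃗(a) - C_n⃗(b))_n⃗`. -/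
def Uvec (S : RDS s) (p : Fin s → ℝ) (a b : EReal) : MI s → ℝ :=
  fun n => Cgen S p n a - Cgen S p n b

end RDS

end

namespace RDSAux

open RDS

variable {s : ℕ}

lemma d_self (S : RDS s) (x : EReal) : S.d x x = 0 := (S.d_eq_zero x x).2 rfl

lemma d_nonneg (S : RDS s) (x y : EReal) : 0 ≤ S.d x y := by
  have h := S.d_triangle x y x
  rw [d_self, S.d_comm y x] at h
  linarith

lemma exists_ball (S : RDS s) {z : EReal} {U : Set EReal} (hU : U ∈ nhds z) :
    ∃ r > 0, ∀ y, S.d z y < r → y ∈ U := by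
  obtain ⟨t, htU, hto, hzt⟩ := mem_nhds_iff.1 hU
  obtain ⟨r, hr, h⟩ := (S.d_top t).1 hto z hzt
  exact ⟨r, hr, fun y hy => htU (h y hy)⟩

lemma ball_nhds (S : RDS s) (z : EReal) {r : ℝ} (hr : 0 < r) :
    {y | S.d z y < r} ∈ nhds z := by
  refine IsOpen.mem_nhds ((S.d_top _).2 ?_) (by simpa [d_self] using hr)
  intro x hx
  refine ⟨r - S.d z x, sub_pos.2 hx, fun y hy => ?_⟩
  have := S.d_triangle z x y
  show S.d z y < r
  linarith

lemma extE_top (f : ℝ → ℝ) : extE f ⊤ = ⊤ := by simp [extE]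
lemma extE_bot (f : ℝ → ℝ) : extE f ⊥ = ⊥ := by simp [extE]
lemma extE_coe (f : ℝ → ℝ) (x : ℝ) : extE f (x : EReal) = ((f x : ℝ) : EReal) := by simp [extE]

lemma extE_inf (f : ℝ → ℝ) {z : EReal} (hz : z = ⊤ ∨ z = ⊥) : extE f z = z := by
  rcases hz with rfl | rfl
  · exact extE_top f
  · exact extE_bot f

lemma contr (S : RDS s) : ∃ r > 0, ∃ c : ℝ, 0 < c ∧ c < 1 ∧ ∀ z : EReal, z = ⊤ ∨ z = ⊥ →
    ∀ i u v, S.d z u < r → S.d z v < r →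
      S.d (extE (S.f i) u) (extE (S.f i) v) ≤ c * S.d u v ∧ S.d z (extE (S.f i) u) < r := by
  obtain ⟨r1, hr1, h1⟩ := exists_ball S S.hVp
  obtain ⟨r2, hr2, h2⟩ := exists_ball S S.hVm
  choose c hc hcp hcm using S.contracting
  have hne : (Finset.univ : Finset (Fin (s+1))).Nonempty := Finset.univ_nonempty
  let c0 := max (1/2) (Finset.univ.sup' hne c)
  have hc0 : c0 < 1 := by
    refine max_lt (by norm_num) ?_
    rw [Finset.sup'_lt_iff]
    intro i _
    exact hc i
  have hc0' : 0 < c0 := lt_of_lt_of_le (by norm_num) (le_max_left _ _)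
  have hci : ∀ i, c i ≤ c0 := fun i => le_trans (Finset.le_sup' c (Finset.mem_univ i)) (le_max_right _ _)
  refine ⟨min r1 r2, lt_min hr1 hr2, c0, hc0', hc0, ?_⟩
  intro z hz
  have key : ∀ i u v, S.d z u < min r1 r2 → S.d z v < min r1 r2 →
      S.d (extE (S.f i) u) (extE (S.f i) v) ≤ c0 * S.d u v := by
    intro i u v hu hv
    have h3 : S.d (extE (S.f i) u) (extE (S.f i) v) ≤ c i * S.d u v := by
      rcases hz with rfl | rfl
      · exact hcp i u (h1 u (lt_of_lt_of_le hu (min_le_left _ _))) v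
          (h1 v (lt_of_lt_of_le hv (min_le_left _ _)))
      · exact hcm i u (h2 u (lt_of_lt_of_le hu (min_le_right _ _))) v
          (h2 v (lt_of_lt_of_le hv (min_le_right _ _)))
    exact h3.trans (mul_le_mul_of_nonneg_right (hci i) (d_nonneg S u v))
  intro i u v hu hv
  refine ⟨key i u v hu hv, ?_⟩
  have h4 := key i z u (by rw [d_self]; exact lt_min hr1 hr2) hu
  rw [extE_inf _ hz] at h4
  have := d_nonneg S z u
  nlinarith

lemma far (S : RDS s) {r : ℝ} (hr : 0 < r) : ∃ R : ℝ, 0 < R ∧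
    (∀ x : EReal, (R : EReal) ≤ x → S.d ⊤ x < r) ∧
    (∀ x : EReal, x ≤ ((-R : ℝ) : EReal) → S.d ⊥ x < r) := by
  obtain ⟨a, ha⟩ := EReal.mem_nhds_top_iff.1 (ball_nhds S ⊤ hr)
  obtain ⟨b, hb⟩ := EReal.mem_nhds_bot_iff.1 (ball_nhds S ⊥ hr)
  refine ⟨|a| + |b| + 1, by positivity, fun x hx => ha ?_, fun x hx => hb ?_⟩
  · refine lt_of_lt_of_le ?_ hx
    rw [EReal.coe_lt_coe_iff]
    have := le_abs_self a
    have := abs_nonneg b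
    linarith
  · refine lt_of_le_of_lt hx ?_
    rw [EReal.coe_lt_coe_iff]
    have := neg_abs_le b
    have := abs_nonneg a
    linarith

lemma bdd (S : RDS s) : ∃ D > 0, ∀ x y, S.d x y ≤ D := by
  obtain ⟨R, hR, hp, hm⟩ := far S one_pos
  obtain ⟨C, hC, hK⟩ := S.d_equiv (Icc (-R) R) isCompact_Icc
  have h0 : ∀ x, S.d ((0:ℝ) : EReal) x ≤ 1 + S.d ((0:ℝ):EReal) ⊤ + S.d ((0:ℝ):EReal) ⊥ + C * R := by
    intro x
    have e1 := d_nonneg S ((0:ℝ):EReal) ⊤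
    have e2 := d_nonneg S ((0:ℝ):EReal) ⊥
    have e3 : 0 < C * R := by positivity
    by_cases h1 : (R : EReal) ≤ x
    · have := hp x h1
      have := S.d_triangle ((0:ℝ):EReal) ⊤ x
      linarith
    by_cases h2 : x ≤ ((-R : ℝ) : EReal)
    · have := hm x h2
      have := S.d_triangle ((0:ℝ):EReal) ⊥ x
      linarith
    push Not at h1 h2
    induction x with
    | bot => simp at h2
    | top => simp at h1
    | coe x =>
      rw [EReal.coe_lt_coe_iff] at h1 h2
      have h3 := (hK 0 ⟨by linarith, by linarith⟩ x ⟨h2.le, h1.le⟩).2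
      have h4 : |0 - x| ≤ R := by rw [zero_sub, abs_neg, abs_le]; exact ⟨h2.le, h1.le⟩
      have h5 : C * |0 - x| ≤ C * R := mul_le_mul_of_nonneg_left h4 hC.le
      linarith
  refine ⟨2 * (1 + S.d ((0:ℝ):EReal) ⊤ + S.d ((0:ℝ):EReal) ⊥ + C * R), ?_, fun x y => ?_⟩
  · have e1 := d_nonneg S ((0:ℝ):EReal) ⊤
    have e2 := d_nonneg S ((0:ℝ):EReal) ⊥
    positivity
  · have := S.d_triangle x ((0:ℝ):EReal) y
    have := S.d_comm x ((0:ℝ):EReal)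
    have := h0 x
    have := h0 y
    linarith

lemma lip1 (S : RDS s) (i : Fin (s+1)) : ∃ L : ℝ, ∀ x y,
    S.d (extE (S.f i) x) (extE (S.f i) y) ≤ L * S.d x y := by
  obtain ⟨r, hr, c, hc, hc1, hcon⟩ := contr S
  obtain ⟨R, hR, hp, hm⟩ := far S (half_pos hr)
  obtain ⟨D, hD, hDb⟩ := bdd S
  have hcont : Continuous (S.f i) := (S.smooth i).continuous
  obtain ⟨C1, hC1, hK1⟩ := S.d_equiv (Icc (-R) R) isCompact_Icc
  obtain ⟨C2, hC2, hK2⟩ := S.d_equiv (S.f i '' Icc (-R) R) (isCompact_Icc.image hcont)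
  obtain ⟨B, hB⟩ := (isCompact_Icc (a := -R) (b := R)).exists_bound_of_continuousOn
    ((S.smooth i).continuous_deriv le_rfl).continuousOn
  have hflip : ∀ x ∈ Icc (-R) R, ∀ y ∈ Icc (-R) R, |S.f i x - S.f i y| ≤ B * |x - y| := by
    intro x hx y hy
    exact Convex.norm_image_sub_le_of_norm_deriv_le (s := Icc (-R) R)
      (fun z _ => ((S.smooth i).differentiable (by norm_num)) z) hB (convex_Icc _ _) hy hx
  have hB0 : 0 ≤ B := (norm_nonneg _).trans (hB 0 ⟨by linarith, by linarith⟩)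
  have hCB : 0 ≤ C2 * B * C1 := by positivity
  have hDr : 0 ≤ 2 * D / r := by positivity
  refine ⟨1 + 2 * D / r + C2 * B * C1, ?_⟩
  intro x y
  have hd := d_nonneg S x y
  by_cases hxy : r / 2 ≤ S.d x y
  · have h1 := hDb (extE (S.f i) x) (extE (S.f i) y)
    have h2 : D ≤ 2 * D / r * S.d x y := by
      have := mul_le_mul_of_nonneg_left hxy hDr
      have e : 2 * D / r * (r / 2) = D := by field_simp
      linarith
    nlinarith
  push Not at hxy
  have key : ∀ z : EReal, z = ⊤ ∨ z = ⊥ → (S.d z x < r/2 ∨ S.d z y < r/2) →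
      S.d (extE (S.f i) x) (extE (S.f i) y) ≤ (1 + 2 * D / r + C2 * B * C1) * S.d x y := by
    intro z hz h
    have : S.d z x < r ∧ S.d z y < r := by
      have t1 := S.d_triangle z x y
      have t2 := S.d_triangle z y x
      rw [S.d_comm y x] at t2
      rcases h with h | h <;> constructor <;> linarith
    have := (hcon z hz i x y this.1 this.2).1
    nlinarith
  by_cases hx1 : (R : EReal) ≤ x
  · exact key ⊤ (Or.inl rfl) (Or.inl (hp x hx1))
  by_cases hx2 : x ≤ ((-R : ℝ) : EReal)
  · exact key ⊥ (Or.inr rfl) (Or.inl (hm x hx2))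
  by_cases hy1 : (R : EReal) ≤ y
  · exact key ⊤ (Or.inl rfl) (Or.inr (hp y hy1))
  by_cases hy2 : y ≤ ((-R : ℝ) : EReal)
  · exact key ⊥ (Or.inr rfl) (Or.inr (hm y hy2))
  push Not at hx1 hx2 hy1 hy2
  induction x with
  | bot => simp at hx2
  | top => simp at hx1
  | coe x =>
  induction y with
  | bot => simp at hy2
  | top => simp at hy1
  | coe y =>
  rw [EReal.coe_lt_coe_iff] at hx1 hx2 hy1 hy2
  have hx : x ∈ Icc (-R) R := ⟨hx2.le, hx1.le⟩
  have hy : y ∈ Icc (-R) R := ⟨hy2.le, hy1.le⟩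
  rw [extE_coe, extE_coe]
  have h1 := (hK2 _ (mem_image_of_mem _ hx) _ (mem_image_of_mem _ hy)).2
  have h2 := hflip x hx y hy
  have h3 := (hK1 x hx y hy).1
  have h4 : |x - y| ≤ C1 * S.d x y := by
    rwa [inv_mul_le_iff₀ hC1] at h3
  calc _ ≤ C2 * |S.f i x - S.f i y| := h1
    _ ≤ C2 * (B * (C1 * S.d x y)) := by gcongr; exact h2.trans (by gcongr)
    _ ≤ _ := by nlinarith

lemma lip (S : RDS s) : ∃ L : ℝ, 1 ≤ L ∧ ∀ i x y,
    S.d (extE (S.f i) x) (extE (S.f i) y) ≤ L * S.d x y := by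
  choose L hL using lip1 S
  have hne : (Finset.univ : Finset (Fin (s+1))).Nonempty := Finset.univ_nonempty
  refine ⟨max 1 (Finset.univ.sup' hne L), le_max_left _ _, fun i x y => (hL i x y).trans ?_⟩
  exact mul_le_mul_of_nonneg_right
    ((Finset.le_sup' L (Finset.mem_univ i)).trans (le_max_right _ _)) (d_nonneg S x y)

lemma expand (S : RDS s) (i : Fin (s+1)) {x y : ℝ} (h : x ≤ y) :
    S.lam * (y - x) ≤ S.f i y - S.f i x :=
  mul_sub_le_image_sub_of_le_deriv ((S.smooth i).differentiable (by norm_num))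
    (S.expanding i) h

lemma exists_fix (S : RDS s) (i : Fin (s+1)) : ∃ x, S.f i x = x := by
  have hl := S.hlam
  have hcont : Continuous (fun x => S.f i x - x) := (S.smooth i).continuous.sub continuous_id
  let T := |S.f i 0| / (S.lam - 1)
  have hT : 0 ≤ T := by have : 0 < S.lam - 1 := by linarith
                        positivity
  have hT' : (S.lam - 1) * T = |S.f i 0| := by
    have : S.lam - 1 ≠ 0 := by linarith
    simp only [T]; field_simp
  have h1 := expand S i hT
  have h2 := expand S i (neg_nonpos.2 hT)
  obtain ⟨x, hx⟩ := mem_range_of_exists_le_of_exists_ge hcont (c := 0)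
    ⟨-T, by have := le_abs_self (S.f i 0); nlinarith⟩
    ⟨T, by have := neg_abs_le (S.f i 0); nlinarith⟩
  exact ⟨x, by simp only at hx; linarith⟩

lemma exists_pivot (S : RDS s) : ∃ c : ℝ, ∃ i j, c < S.f i c ∧ S.f j c < c := by
  have hl := S.hlam
  have main : ∀ i j (a b : ℝ), S.f i a = a → S.f j b = b → a < b →
      ∃ c : ℝ, ∃ i j, c < S.f i c ∧ S.f j c < c := by
    intro i j a b ha hb hab
    refine ⟨(a+b)/2, i, j, ?_, ?_⟩
    · have := expand S i (show a ≤ (a+b)/2 by linarith)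
      nlinarith
    · have := expand S j (show (a+b)/2 ≤ b by linarith)
      nlinarith
  choose z hz using exists_fix S
  by_cases h : ∀ i, z i = z 0
  · exact absurd ⟨z 0, fun i => by have := hz i; rwa [h i] at this⟩ S.noCommonFix
  · push Not at h
    obtain ⟨i, hi⟩ := h
    rcases lt_or_gt_of_ne hi with h | h
    · exact main i 0 _ _ (hz i) (hz 0) h
    · exact main 0 i _ _ (hz 0) (hz i) h

lemma iter_up {f : ℝ → ℝ} {c t : ℝ} (ht : 0 ≤ t) (hf : ∀ u, c ≤ u → u + t ≤ f u)
    {x : EReal} (hx : (c : EReal) ≤ x) (m : ℕ) :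
    ((c + m * t : ℝ) : EReal) ≤ (extE f)^[m] x := by
  induction m with
  | zero => simpa using hx
  | succ m ih =>
    rw [Function.iterate_succ_apply']
    generalize (extE f)^[m] x = w at ih
    induction w with
    | bot => exact absurd (le_bot_iff.1 ih) (EReal.coe_ne_bot _)
    | top => rw [extE_top]; exact le_top
    | coe w =>
      rw [EReal.coe_le_coe_iff] at ih
      rw [extE_coe, EReal.coe_le_coe_iff]
      have : c ≤ w := by have : 0 ≤ (m:ℝ) * t := by positivity
                         linarith
      have := hf w this
      push_cast
      linarith

lemma iter_down {f : ℝ → ℝ} {c t : ℝ} (ht : 0 ≤ t) (hf : ∀ u, u ≤ c → f u ≤ u - t)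
    {x : EReal} (hx : x ≤ (c : EReal)) (m : ℕ) :
    (extE f)^[m] x ≤ ((c - m * t : ℝ) : EReal) := by
  induction m with
  | zero => simpa using hx
  | succ m ih =>
    rw [Function.iterate_succ_apply']
    generalize (extE f)^[m] x = w at ih
    induction w with
    | top => exact absurd (top_le_iff.1 ih) (EReal.coe_ne_top _)
    | bot => rw [extE_bot]; exact bot_le
    | coe w =>
      rw [EReal.coe_le_coe_iff] at ih
      rw [extE_coe, EReal.coe_le_coe_iff]
      have : w ≤ c := by have : 0 ≤ (m:ℝ) * t := by positivity
                         linarith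
      have := hf w this
      push_cast
      linarith

lemma reach (S : RDS s) {r : ℝ} (hr : 0 < r) : ∃ m : ℕ, 0 < m ∧ ∀ x : EReal, ∃ i, ∃ z : EReal,
    (z = ⊤ ∨ z = ⊥) ∧ S.d z ((extE (S.f i))^[m] x) < r := by
  have hl := S.hlam
  obtain ⟨R, hR, hp, hm⟩ := far S hr
  obtain ⟨c, i, j, hi, hj⟩ := exists_pivot S
  set t := min (S.f i c - c) (c - S.f j c) with ht
  have ht0 : 0 < t := lt_min (by linarith) (by linarith)
  have ht1 : t ≤ S.f i c - c := min_le_left _ _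
  have ht2 : t ≤ c - S.f j c := min_le_right _ _
  obtain ⟨m, hmm⟩ := exists_nat_gt ((R + |c|) / t)
  rw [div_lt_iff₀ ht0] at hmm
  have hc1 := le_abs_self c
  have hc2 := neg_abs_le c
  refine ⟨m, ?_, fun x => ?_⟩
  · rcases Nat.eq_zero_or_pos m with rfl | h
    · have := abs_nonneg c
      simp at hmm; linarith
    · exact h
  rcases le_total (c : EReal) x with hx | hx
  · refine ⟨i, ⊤, Or.inl rfl, hp _ (le_trans ?_ (iter_up ht0.le ?_ hx m))⟩
    · rw [EReal.coe_le_coe_iff]; linarith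
    · intro u hu
      have := expand S i hu
      nlinarith
  · refine ⟨j, ⊥, Or.inr rfl, hm _ (le_trans (iter_down ht0.le ?_ hx m) ?_)⟩
    · intro u hu
      have := expand S j hu
      nlinarith
    · rw [EReal.coe_le_coe_iff]; linarith

lemma pfull_sum (p : Fin s → ℝ) : ∑ i, pfull p i = 1 := by
  rw [Fin.sum_univ_castSucc]
  simp [pfull]

lemma pfull_cont (i : Fin (s+1)) : Continuous (fun p : Fin s → ℝ => pfull p i) := by
  unfold pfull
  by_cases h : (i : ℕ) < s
  · simp only [h, dite_true]; fun_prop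
  · simp only [h, dite_false]; fun_prop

lemma pfull_pos {p : Fin s → ℝ} (hp : ProbVec p) (i : Fin (s+1)) : 0 < pfull p i := by
  unfold pfull
  split_ifs with h
  · exact (hp.1 _).1
  · have := hp.2; linarith

lemma exists_eta {p₀ : Fin s → ℝ} (hp₀ : ProbVec p₀) : ∃ δ > 0, ∃ η : ℝ, 0 < η ∧ η < 1 ∧
    ∀ p, dist p p₀ < δ → ∀ i, η ≤ pfull p i := by
  have hne : (Finset.univ : Finset (Fin (s+1))).Nonempty := Finset.univ_nonempty
  let μ := Finset.univ.inf' hne (pfull p₀)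
  have hμ : 0 < μ := by
    rw [Finset.lt_inf'_iff]
    intro i _
    exact pfull_pos hp₀ i
  let η := min (1/2) (μ/2)
  have h : ∀ᶠ p in nhds p₀, ∀ i, η < pfull p i := by
    rw [eventually_all]
    intro i
    refine (pfull_cont i).continuousAt.eventually (lt_mem_nhds ?_)
    have : μ ≤ pfull p₀ i := Finset.inf'_le _ (Finset.mem_univ i)
    have : η ≤ μ / 2 := min_le_right _ _
    show η < pfull p₀ i
    linarith
  obtain ⟨δ, hδ, hh⟩ := Metric.eventually_nhds_iff.1 h
  exact ⟨δ, hδ, η, lt_min (by norm_num) (by linarith),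
    lt_of_le_of_lt (min_le_left _ _) (by norm_num), fun p hp i => (hh hp i).le⟩



lemma Mop_succ (S : RDS s) (q : Fin (s+1) → ℝ) (n : ℕ) (h : EReal → ℝ) (x : EReal) :
    (Mop S q)^[n+1] h x = ∑ i, q i * (Mop S q)^[n] h (extE (S.f i) x) := by
  rw [Function.iterate_succ_apply']
  rfl

lemma Mop_diff (S : RDS s) {q : Fin (s+1) → ℝ} (hq : ∀ i, 0 ≤ q i) (n : ℕ) (h : EReal → ℝ) (x y : EReal) :
    |(Mop S q)^[n+1] h x - (Mop S q)^[n+1] h y| ≤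
      ∑ i, q i * |(Mop S q)^[n] h (extE (S.f i) x) - (Mop S q)^[n] h (extE (S.f i) y)| := by
  rw [Mop_succ, Mop_succ, ← Finset.sum_sub_distrib]
  refine (Finset.abs_sum_le_sum_abs _ _).trans (le_of_eq ?_)
  refine Finset.sum_congr rfl fun i _ => ?_
  rw [← mul_sub, abs_mul, abs_of_nonneg (hq i)]

lemma Mop_bound (S : RDS s) {q : Fin (s+1) → ℝ} (hq : ∀ i, 0 ≤ q i) (hq1 : ∑ i, q i = 1)
    {h : EReal → ℝ} {H : ℝ} (hH : ∀ x, |h x| ≤ H) (n : ℕ) (x : EReal) :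
    |(Mop S q)^[n] h x| ≤ H := by
  induction n generalizing x with
  | zero => exact hH x
  | succ n ih =>
    rw [Mop_succ]
    calc _ ≤ ∑ i, |q i * (Mop S q)^[n] h (extE (S.f i) x)| := Finset.abs_sum_le_sum_abs _ _
      _ ≤ ∑ i, q i * H := by
        refine Finset.sum_le_sum fun i _ => ?_
        rw [abs_mul, abs_of_nonneg (hq i)]
        exact mul_le_mul_of_nonneg_left (ih _) (hq i)
      _ = H := by rw [← Finset.sum_mul, hq1, one_mul]

/-- deterministic contraction near infinity -/
lemma Mop_contr (S : RDS s) {q : Fin (s+1) → ℝ} (hq : ∀ i, 0 ≤ q i) (hq1 : ∑ i, q i = 1)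
    {r c α K : ℝ} (hc : 0 < c) (hα : 0 < α) (hK : 0 ≤ K) {z : EReal}
    (hcon : ∀ i u v, S.d z u < r → S.d z v < r →
      S.d (extE (S.f i) u) (extE (S.f i) v) ≤ c * S.d u v ∧ S.d z (extE (S.f i) u) < r)
    {h : EReal → ℝ} (hh : ∀ x y, |h x - h y| ≤ K * S.d x y ^ α) (n : ℕ) {u v : EReal}
    (hu : S.d z u < r) (hv : S.d z v < r) :
    |(Mop S q)^[n] h u - (Mop S q)^[n] h v| ≤ (c ^ α) ^ n * K * S.d u v ^ α := by
  induction n generalizing u v with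
  | zero => simpa using hh u v
  | succ n ih =>
    calc _ ≤ _ := Mop_diff S hq n h u v
      _ ≤ ∑ i, q i * ((c ^ α) ^ (n+1) * K * S.d u v ^ α) := by
        refine Finset.sum_le_sum fun i _ => mul_le_mul_of_nonneg_left ?_ (hq i)
        have hcn : 0 ≤ (c ^ α) ^ n * K := by positivity
        calc _ ≤ (c ^ α) ^ n * K * S.d (extE (S.f i) u) (extE (S.f i) v) ^ α :=
              ih (hcon i u v hu hv).2 (hcon i v u hv hu).2
          _ ≤ (c ^ α) ^ n * K * (c * S.d u v) ^ α := by
              refine mul_le_mul_of_nonneg_left ?_ hcn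
              exact Real.rpow_le_rpow (d_nonneg S _ _) (hcon i u v hu hv).1 hα.le
          _ = _ := by rw [Real.mul_rpow hc.le (d_nonneg S _ _)]; ring
      _ = _ := by rw [← Finset.sum_mul, hq1, one_mul]

/-- one block estimate, isolating the constant word `i ^ m` -/
lemma Mop_block (S : RDS s) {q : Fin (s+1) → ℝ} (hq : ∀ i, 0 ≤ q i) (hq1 : ∑ i, q i = 1)
    {L α β r : ℝ} (hL : 1 ≤ L) (hα : 0 < α) (hβ : 0 ≤ β)
    (hlip : ∀ i x y, S.d (extE (S.f i) x) (extE (S.f i) y) ≤ L * S.d x y)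
    {g : EReal → ℝ} (hg : ∀ x y, S.d x y < r → |g x - g y| ≤ β * S.d x y ^ α)
    (i : Fin (s+1)) (m : ℕ) {x y : EReal} (hxy : L ^ m * S.d x y < r) :
    |(Mop S q)^[m] g x - (Mop S q)^[m] g y| ≤
      q i ^ m * |g ((extE (S.f i))^[m] x) - g ((extE (S.f i))^[m] y)|
        + (1 - q i ^ m) * ((L ^ α) ^ m * β * S.d x y ^ α) := by
  have hLp : 0 < L := by linarith
  have hqi : ∀ i, q i ≤ 1 := fun i => by
    rw [← hq1]; exact Finset.single_le_sum (fun j _ => hq j) (Finset.mem_univ i)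
  have hstep : ∀ (m : ℕ) j x y, (L ^ α) ^ m * β * S.d (extE (S.f j) x) (extE (S.f j) y) ^ α ≤
      (L ^ α) ^ (m+1) * β * S.d x y ^ α := by
    intro m j x y
    have : 0 ≤ (L ^ α) ^ m * β := by positivity
    calc _ ≤ (L ^ α) ^ m * β * (L * S.d x y) ^ α := by
          refine mul_le_mul_of_nonneg_left ?_ this
          exact Real.rpow_le_rpow (d_nonneg S _ _) (hlip j x y) hα.le
      _ = _ := by rw [Real.mul_rpow hLp.le (d_nonneg S _ _)]; ring
  have hrad : ∀ (m : ℕ) j x y, L ^ (m+1) * S.d x y < r →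
      L ^ m * S.d (extE (S.f j) x) (extE (S.f j) y) < r := by
    intro m j x y h
    refine lt_of_le_of_lt ?_ h
    rw [pow_succ, mul_assoc]
    exact mul_le_mul_of_nonneg_left (hlip j x y) (by positivity)
  have hall : ∀ (m : ℕ) x y, L ^ m * S.d x y < r →
      |(Mop S q)^[m] g x - (Mop S q)^[m] g y| ≤ (L ^ α) ^ m * β * S.d x y ^ α := by
    intro m
    induction m with
    | zero => intro x y h; simpa using hg x y (by simpa using h)
    | succ m ih =>
      intro x y h
      calc _ ≤ _ := Mop_diff S hq m g x y
        _ ≤ ∑ j, q j * ((L ^ α) ^ (m+1) * β * S.d x y ^ α) := by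
          refine Finset.sum_le_sum fun j _ => mul_le_mul_of_nonneg_left ?_ (hq j)
          exact (ih _ _ (hrad m j x y h)).trans (hstep m j x y)
        _ = _ := by rw [← Finset.sum_mul, hq1, one_mul]
  induction m generalizing x y with
  | zero => simp
  | succ m ih =>
    set E := (L ^ α) ^ (m+1) * β * S.d x y ^ α with hE
    have hsplit : ∀ F : Fin (s+1) → ℝ, ∑ j, F j = F i + ∑ j ∈ Finset.univ.erase i, F j :=
      fun F => (Finset.add_sum_erase _ _ (Finset.mem_univ i)).symm
    have hqe : ∑ j ∈ Finset.univ.erase i, q j = 1 - q i := by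
      have := hsplit q; linarith
    have h1 := ih (hrad m i x y hxy)
    have h2 : (1 - q i ^ m) * ((L ^ α) ^ m * β * S.d (extE (S.f i) x) (extE (S.f i) y) ^ α) ≤
        (1 - q i ^ m) * E :=
      mul_le_mul_of_nonneg_left (hstep m i x y) (sub_nonneg.2 (pow_le_one₀ (hq i) (hqi i)))
    have h3 := (Mop_diff S hq m g x y)
    rw [hsplit] at h3
    have h4 : ∑ j ∈ Finset.univ.erase i, q j *
        |(Mop S q)^[m] g (extE (S.f j) x) - (Mop S q)^[m] g (extE (S.f j) y)| ≤
        (1 - q i) * E := by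
      rw [← hqe, Finset.sum_mul]
      refine Finset.sum_le_sum fun j _ => mul_le_mul_of_nonneg_left ?_ (hq j)
      exact (hall m _ _ (hrad m j x y hxy)).trans (hstep m j x y)
    rw [Function.iterate_succ_apply, Function.iterate_succ_apply (extE (S.f i))]
    have h5 := mul_le_mul_of_nonneg_left (h1.trans (add_le_add le_rfl h2)) (hq i)
    rw [Function.iterate_succ_apply (extE (S.f i))]
    rw [← Function.iterate_succ_apply (Mop S q)]
    refine h3.trans ((add_le_add h5 h4).trans (le_of_eq ?_))
    ring


lemma exists_alpha {L κ : ℝ} (hL : 1 ≤ L) (hκ : 0 < κ) (m : ℕ) :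
    ∃ α : ℝ, 0 < α ∧ (L ^ α) ^ m * (1 - κ) < 1 := by
  have hLp : 0 < L := by linarith
  have hc : Continuous (fun α : ℝ => (L ^ α) ^ m * (1 - κ)) :=
    ((Real.continuous_const_rpow hLp.ne').pow m).mul continuous_const
  have h0 : ∀ᶠ α in nhds (0:ℝ), (L ^ α) ^ m * (1 - κ) < 1 := by
    refine hc.continuousAt.eventually (gt_mem_nhds ?_)
    simp [hκ]
  have h1 : ∀ᶠ α in nhdsWithin (0:ℝ) (Ioi 0), (L ^ α) ^ m * (1 - κ) < 1 :=
    h0.filter_mono nhdsWithin_le_nhds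
  obtain ⟨α, ha, hb⟩ := (h1.and self_mem_nhdsWithin).exists
  exact ⟨α, hb, ha⟩

end RDSAux

/-- **Lemma (Ionescu-Tulcea–Marinescu inequality, Lemma 2.3).**
For every `p⃗₀ ∈ (0,1)^s` with `∑ (p₀)_i < 1` there exist `δ > 0`, `α > 0`, `n ∈ ℕ` and
constants `0 < c < 1`, `C > 0` such that for every `p⃗ ∈ B(p⃗₀, δ)` and every
`h ∈ C^α(ℝ̄)`: `|M_p⃗ⁿ h(x) - M_p⃗ⁿ h(y)| ≤ (c ‖h‖_α + C ‖h‖_∞) d(x,y)^α` for all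
`x, y ∈ ℝ̄`. -/
theorem doeblin_fortet_general {s : ℕ} (S : RDS s) (p₀ : Fin s → ℝ) (hp₀ : ProbVec p₀) :
    ∃ δ > (0 : ℝ), ∃ α > (0 : ℝ), ∃ n : ℕ, 0 < n ∧ ∃ c : ℝ, 0 < c ∧ c < 1 ∧
      ∃ C : ℝ, 0 < C ∧
        ∀ p : Fin s → ℝ, dist p p₀ < δ → ProbVec p →
          ∀ h : EReal → ℝ, RDS.MemHolder S α h →
            ∀ x y : EReal,
              |(RDS.Mop S (pfull p))^[n] h x - (RDS.Mop S (pfull p))^[n] h y| ≤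
                (c * RDS.hNorm S α h + C * RDS.supN h) * S.d x y ^ α := by
  classical
  obtain ⟨δ, hδ, η, hη, hη1, hpη⟩ := RDSAux.exists_eta hp₀
  obtain ⟨r, hr, c, hc, hc1, hcon⟩ := RDSAux.contr S
  obtain ⟨L, hL, hlip⟩ := RDSAux.lip S
  obtain ⟨D, hD, hDb⟩ := RDSAux.bdd S
  obtain ⟨m, hm, hreach⟩ := RDSAux.reach S (half_pos hr)
  obtain ⟨α, hα, hρ⟩ := RDSAux.exists_alpha hL (pow_pos hη m) m
  have hLp : 0 < L := by linarith
  set A := (L ^ α) ^ m with hA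
  set ρ := A * (1 - η ^ m) with hρdef
  set Q := (c ^ α) ^ m with hQ
  have hA1 : 0 < A := by positivity
  have hηm : η ^ m ≤ 1 := pow_le_one₀ hη.le hη1.le
  have hρ0 : 0 ≤ ρ := mul_nonneg hA1.le (by linarith)
  have hQ0 : 0 < Q := by positivity
  have hQ1 : Q < 1 := pow_lt_one₀ (by positivity) (Real.rpow_lt_one hc.le hc1 hα) hm.ne'
  obtain ⟨θ, hθ, hθ1⟩ := exists_between (max_lt hQ1 hρ)
  have hθQ : Q < θ := lt_of_le_of_lt (le_max_left _ _) hθ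
  have hθρ : ρ < θ := lt_of_le_of_lt (le_max_right _ _) hθ
  have hθ0 : 0 < θ := hQ0.trans hθQ
  set B := max 1 (A / (θ - ρ)) with hB
  have hB1 : 1 ≤ B := le_max_left _ _
  have hBA : A ≤ B * (θ - ρ) := by
    have : A / (θ - ρ) ≤ B := le_max_right _ _
    rwa [div_le_iff₀ (sub_pos.2 hθρ)] at this
  have hiter : ∀ i (n : ℕ) x y, S.d ((extE (S.f i))^[n] x) ((extE (S.f i))^[n] y) ≤
      L ^ n * S.d x y := by
    intro i n x y
    induction n with
    | zero => simp
    | succ n ih =>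
      rw [Function.iterate_succ_apply', Function.iterate_succ_apply']
      calc _ ≤ L * _ := hlip i _ _
        _ ≤ L * (L ^ n * S.d x y) := mul_le_mul_of_nonneg_left ih hLp.le
        _ = _ := by ring
  have main : ∀ k : ℕ, ∃ t > 0, ∀ p : Fin s → ℝ, dist p p₀ < δ → ProbVec p →
      ∀ (h : EReal → ℝ) (K : ℝ), 0 ≤ K → (∀ x y, |h x - h y| ≤ K * S.d x y ^ α) →
      ∀ x y, S.d x y < t →
        |(RDS.Mop S (pfull p))^[m * k] h x - (RDS.Mop S (pfull p))^[m * k] h y| ≤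
          (B * θ ^ k * K) * S.d x y ^ α := by
    intro k
    induction k with
    | zero =>
      refine ⟨1, one_pos, fun p _ _ h K hK hh x y _ => ?_⟩
      simp only [mul_zero, Function.iterate_zero, id, pow_zero, mul_one]
      have := Real.rpow_nonneg (RDSAux.d_nonneg S x y) α
      refine (hh x y).trans (mul_le_mul_of_nonneg_right ?_ this)
      nlinarith
    | succ k ih =>
      obtain ⟨t, ht, ih⟩ := ih
      refine ⟨min t (r/2) / L ^ m, by positivity, fun p hp hpv h K hK hh x y hxy => ?_⟩
      rw [lt_div_iff₀ (by positivity), mul_comm] at hxy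
      have hxt : L ^ m * S.d x y < t := lt_of_lt_of_le hxy (min_le_left _ _)
      have hxr : L ^ m * S.d x y < r / 2 := lt_of_lt_of_le hxy (min_le_right _ _)
      have hq : ∀ i, 0 ≤ pfull p i := fun i => (RDSAux.pfull_pos hpv i).le
      have hq1 := RDSAux.pfull_sum p
      have hqle : ∀ i, pfull p i ≤ 1 := fun i => by
        rw [← hq1]; exact Finset.single_le_sum (fun j _ => hq j) (Finset.mem_univ i)
      obtain ⟨i, z, hz, hzx⟩ := hreach x
      have hdx := Real.rpow_nonneg (RDSAux.d_nonneg S x y) α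
      have hβ : 0 ≤ B * θ ^ k * K := by positivity
      have h1 := RDSAux.Mop_block S hq hq1 hL hα hβ hlip (ih p hp hpv h K hK hh) i m hxt
      have hit := hiter i m x y
      have hzy : S.d z ((extE (S.f i))^[m] y) < r := by
        have := S.d_triangle z ((extE (S.f i))^[m] x) ((extE (S.f i))^[m] y)
        linarith
      have h2 := RDSAux.Mop_contr S hq hq1 hc hα hK (hcon z hz) hh (m * k)
        (hzx.trans (by linarith)) hzy
      have h3 : S.d ((extE (S.f i))^[m] x) ((extE (S.f i))^[m] y) ^ α ≤ A * S.d x y ^ α := by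
        refine (Real.rpow_le_rpow (RDSAux.d_nonneg S _ _) hit hα.le).trans (le_of_eq ?_)
        rw [Real.mul_rpow (by positivity) (RDSAux.d_nonneg S _ _), hA, ← Real.rpow_natCast,
          ← Real.rpow_mul hLp.le, mul_comm (m:ℝ) α, Real.rpow_mul hLp.le, Real.rpow_natCast]
      rw [pow_mul] at h2
      have hQk : Q ^ k ≤ θ ^ k := pow_le_pow_left₀ hQ0.le hθQ.le k
      have hθk : 0 < θ ^ k := by positivity
      have h4 : |(RDS.Mop S (pfull p))^[m * k] h ((extE (S.f i))^[m] x) -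
          (RDS.Mop S (pfull p))^[m * k] h ((extE (S.f i))^[m] y)| ≤
          θ ^ k * K * (A * S.d x y ^ α) := by
        refine h2.trans ?_
        have h0 := Real.rpow_nonneg (RDSAux.d_nonneg S ((extE (S.f i))^[m] x) ((extE (S.f i))^[m] y)) α
        gcongr
      have h5 : pfull p i ^ m ≤ 1 := pow_le_one₀ (hq i) (hqle i)
      have h6 : η ^ m ≤ pfull p i ^ m := pow_le_pow_left₀ hη.le (hpη p hp i) m
      have hW : 0 ≤ θ ^ k * K * (A * S.d x y ^ α) := by positivity
      rw [mul_add, mul_one, add_comm, Function.iterate_add_apply]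
      have h7 : pfull p i ^ m * |(RDS.Mop S (pfull p))^[m * k] h ((extE (S.f i))^[m] x) -
          (RDS.Mop S (pfull p))^[m * k] h ((extE (S.f i))^[m] y)| ≤
          θ ^ k * K * (A * S.d x y ^ α) :=
        (mul_le_of_le_one_left (abs_nonneg _) h5).trans h4
      have h8 : (1 - pfull p i ^ m) * (A * (B * θ ^ k * K) * S.d x y ^ α) ≤
          (1 - η ^ m) * (A * (B * θ ^ k * K) * S.d x y ^ α) :=
        mul_le_mul_of_nonneg_right (by linarith) (by positivity)
      refine h1.trans ((add_le_add h7 h8).trans ?_)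
      have h9 : (A + ρ * B) * (θ ^ k * K * S.d x y ^ α) ≤
          (B * θ) * (θ ^ k * K * S.d x y ^ α) :=
        mul_le_mul_of_nonneg_right (by linarith) (by positivity)
      calc _ = (A + ρ * B) * (θ ^ k * K * S.d x y ^ α) := by rw [hρdef]; ring
        _ ≤ _ := h9
        _ = _ := by ring
  have hlim : Tendsto (fun k : ℕ => B * θ ^ k) atTop (nhds 0) := by
    simpa using (tendsto_pow_atTop_nhds_zero_of_lt_one hθ0.le hθ1).const_mul B
  obtain ⟨k, hk, hk1⟩ := ((hlim.eventually (gt_mem_nhds (show (0:ℝ) < 1/2 by norm_num))).and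
    (eventually_ge_atTop 1)).exists
  obtain ⟨t, ht, hmain⟩ := main k
  have htα : 0 < t ^ α := by positivity
  refine ⟨δ, hδ, α, hα, m * k, Nat.mul_pos hm hk1, 1/2, by norm_num, by norm_num,
    2 / t ^ α, by positivity, ?_⟩
  intro p hp hpv h hh x y
  have hq : ∀ i, 0 ≤ pfull p i := fun i => (RDSAux.pfull_pos hpv i).le
  have hq1 := RDSAux.pfull_sum p
  have hdx := Real.rpow_nonneg (RDSAux.d_nonneg S x y) α
  obtain ⟨K₀, hK₀⟩ := hh
  have hK₁ : ∀ x y, |h x - h y| ≤ max K₀ 0 * S.d x y ^ α := fun x y =>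
    (hK₀ x y).trans (mul_le_mul_of_nonneg_right (le_max_left _ _)
      (Real.rpow_nonneg (RDSAux.d_nonneg S x y) α))
  have hbdd : BddAbove (range fun x => |h x|) := by
    refine ⟨|h 0| + max K₀ 0 * D ^ α, ?_⟩
    rintro _ ⟨x, rfl⟩
    have e1 := hK₁ x 0
    have e2 : max K₀ 0 * S.d x 0 ^ α ≤ max K₀ 0 * D ^ α :=
      mul_le_mul_of_nonneg_left (Real.rpow_le_rpow (RDSAux.d_nonneg S _ _) (hDb _ _) hα.le)
        (le_max_right _ _)
    have e3 := abs_sub_abs_le_abs_sub (h x) (h 0)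
    simp only
    linarith
  have hsup : ∀ x, |h x| ≤ RDS.supN h := fun x => le_ciSup hbdd x
  have hsup0 : 0 ≤ RDS.supN h := (abs_nonneg _).trans (hsup 0)
  set T := {K : ℝ | 0 ≤ K ∧ ∀ x y, |h x - h y| ≤ K * S.d x y ^ α} with hT
  have hTne : T.Nonempty := ⟨_, le_max_right _ _, hK₁⟩
  have hsemi0 : 0 ≤ RDS.hSemi S α h := le_csInf hTne fun K hK => hK.1
  have hsemi : ∀ x y, |h x - h y| ≤ RDS.hSemi S α h * S.d x y ^ α := by
    intro x y
    rcases (Real.rpow_nonneg (RDSAux.d_nonneg S x y) α).eq_or_lt with h0 | h0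
    · have := hK₁ x y
      rw [← h0] at this ⊢
      simpa using this
    · rw [← div_le_iff₀ h0]
      exact le_csInf hTne fun K hK => by rw [div_le_iff₀ h0]; exact hK.2 x y
  by_cases hxy : S.d x y < t
  · refine (hmain p hp hpv h _ hsemi0 hsemi x y hxy).trans
      (mul_le_mul_of_nonneg_right ?_ hdx)
    unfold RDS.hNorm
    have : 0 ≤ 2 / t ^ α * RDS.supN h := by positivity
    nlinarith
  · push Not at hxy
    have e1 := RDSAux.Mop_bound S hq hq1 hsup (m * k) x
    have e2 := RDSAux.Mop_bound S hq hq1 hsup (m * k) y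
    have e3 := abs_sub ((RDS.Mop S (pfull p))^[m * k] h x) ((RDS.Mop S (pfull p))^[m * k] h y)
    have e4 : t ^ α ≤ S.d x y ^ α := Real.rpow_le_rpow ht.le hxy hα.le
    have e5 : 2 * RDS.supN h ≤ 2 / t ^ α * RDS.supN h * S.d x y ^ α := by
      have := mul_le_mul_of_nonneg_left e4 (show 0 ≤ 2 / t ^ α * RDS.supN h by positivity)
      have e : 2 / t ^ α * RDS.supN h * t ^ α = 2 * RDS.supN h := by field_simp
      linarith
    have e6 : 0 ≤ 1 / 2 * RDS.hNorm S α h * S.d x y ^ α := by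
      unfold RDS.hNorm; positivity
    rw [add_mul]
    linarith
end

section
/- The kernel Julia set J_ker = ∩_{g∈G} g^{-1}(J) is empty. Moreover, for each x ∈ ℝ one has μ_p⃗({ω ∈ Σ : x ∈ J_ω}) = 0, where J_ω = ∩_{n∈ℕ} (f_{ω|n})^{-1}(ℝ̄∖V). -/
open MeasureTheory Filter Topology Set

namespace KJ

open RDS

variable {s : ℕ}

open Classical in
/-- Probability of surviving in `K` for `n` steps. -/
noncomputable def Q (f : Fin (s + 1) → ℝ → ℝ) (p : Fin (s + 1) → ℝ) (K : Set ℝ) : ℕ → ℝ → ℝ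
  | 0 => fun y => if y ∈ K then 1 else 0
  | n + 1 => fun y => if y ∈ K then ∑ i, p i * Q f p K n (f i y) else 0

/-- Survival of a finite word. -/
def surv (f : Fin (s + 1) → ℝ → ℝ) (K : Set ℝ) : (n : ℕ) → ℝ → (Fin n → Fin (s + 1)) → Prop
  | 0 => fun y _ => y ∈ K
  | n + 1 => fun y w => y ∈ K ∧ surv f K n (f (w 0) y) (Fin.tail w)

open Classical in
lemma sum_surv (f : Fin (s + 1) → ℝ → ℝ) (p : Fin (s + 1) → ℝ) (K : Set ℝ) (n : ℕ) :
    ∀ y, ∑ w : Fin n → Fin (s + 1), (if surv f K n y w then ∏ k, p (w k) else 0)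
      = Q f p K n y := by
  induction n with
  | zero => intro y; simp [surv, Q]
  | succ n ih =>
    intro y
    rw [← (Fin.consEquiv (fun _ : Fin (n + 1) => Fin (s + 1))).sum_comp, Fintype.sum_prod_type]
    by_cases hy : y ∈ K
    · simp only [Q, hy, if_true]
      refine Finset.sum_congr rfl fun i _ => ?_
      rw [← ih, Finset.mul_sum]
      refine Finset.sum_congr rfl fun w _ => ?_
      simp [surv, Fin.consEquiv, hy, Fin.prod_univ_succ]
    · simp [surv, Q, hy]

lemma itR_succ' (S : RDS s) (ω : Word s) (n : ℕ) (y : ℝ) :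
    itR S ω (n + 1) y = itR S (shiftW ω) n (S.f (ω 0) y) := by
  induction n with
  | zero => rfl
  | succ n ih =>
    change S.f (ω (n + 1)) (itR S ω (n + 1) y) = _
    rw [ih]; rfl

lemma surv_of (S : RDS s) (K : Set ℝ) (n : ℕ) : ∀ (y : ℝ) (ω : Word s),
    (∀ k ≤ n, itR S ω k y ∈ K) → surv S.f K n y (fun k => ω k) := by
  induction n with
  | zero => intro y ω h; exact h 0 le_rfl
  | succ n ih =>
    intro y ω h
    refine ⟨h 0 (Nat.zero_le _), ?_⟩
    have := ih (S.f (ω 0) y) (shiftW ω) (fun k hk => by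
      rw [← itR_succ']; exact h (k + 1) (by omega))
    exact this

lemma extE_coe (f : ℝ → ℝ) (x : ℝ) : extE f (x : EReal) = ((f x : ℝ) : EReal) := by
  simp [extE]

lemma itE_coe (S : RDS s) (ω : Word s) (n : ℕ) (x : ℝ) :
    itE S ω n (x : EReal) = ((itR S ω n x : ℝ) : EReal) := by
  induction n with
  | zero => rfl
  | succ n ih =>
    change extE _ (itE S ω n (x : EReal)) = _
    rw [ih, extE_coe]; rfl

lemma measure_le (S : RDS s) (p : Fin (s + 1) → ℝ) (hp : ∀ i, 0 < p i) (μ : Measure (Word s))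
    (hμ : IsBernoulli p μ) (K : Set ℝ) (n : ℕ) (y : ℝ) :
    μ {ω | ∀ k, itR S ω k y ∈ K} ≤ ENNReal.ofReal (Q S.f p K n y) := by
  classical
  rw [← sum_surv]
  have hnn : ∀ w : Fin n → Fin (s + 1), 0 ≤ ∏ k, p (w k) :=
    fun w => Finset.prod_nonneg fun k _ => (hp _).le
  rw [ENNReal.ofReal_sum_of_nonneg (fun w _ => by split_ifs; exacts [hnn w, le_rfl])]
  calc μ {ω | ∀ k, itR S ω k y ∈ K}
      ≤ μ (⋃ w ∈ (Finset.univ.filter (fun w : Fin n → Fin (s + 1) => surv S.f K n y w)),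
          {ω : Word s | ∀ k : Fin n, ω (k : ℕ) = w k}) := by
        refine measure_mono fun ω hω => ?_
        simp only [mem_iUnion]
        refine ⟨fun k => ω k, ?_, fun k => rfl⟩
        simpa using surv_of S K n y ω (fun k _ => hω k)
    _ ≤ ∑ w ∈ (Finset.univ.filter (fun w : Fin n → Fin (s + 1) => surv S.f K n y w)),
          μ {ω : Word s | ∀ k : Fin n, ω (k : ℕ) = w k} := measure_biUnion_finset_le _ _
    _ = _ := by
        rw [Finset.sum_filter]
        refine Finset.sum_congr rfl fun w _ => ?_
        split_ifs
        · exact hμ.2 n w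
        · simp

open Classical in
lemma Q_step (f : Fin (s + 1) → ℝ → ℝ) (p : Fin (s + 1) → ℝ) (hp : ∀ i, 0 < p i)
    (hp1 : ∑ i, p i = 1) (K : Set ℝ) (n : ℕ) (M : ℝ) (hM : 0 ≤ M)
    (hQ : ∀ y, Q f p K n y ≤ M) (m : ℕ) : (∀ y, Q f p K (n + m) y ≤ M) ∧
    ∀ (i : Fin (s + 1)) (y : ℝ), (f i)^[m] y ∉ K → Q f p K (n + m) y ≤ M * (1 - p i ^ m) := by
  induction m with
  | zero =>
    refine ⟨hQ, fun i y hy => ?_⟩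
    have hy' : y ∉ K := hy
    cases n <;> simp [Q, hy']
  | succ m ih =>
    have hsum : ∑ i, p i * M = M := by rw [← Finset.sum_mul, hp1, one_mul]
    constructor
    · intro y
      change (if y ∈ K then ∑ i, p i * Q f p K (n + m) (f i y) else 0) ≤ M
      split_ifs
      · calc _ ≤ ∑ i, p i * M := Finset.sum_le_sum fun i _ =>
              mul_le_mul_of_nonneg_left (ih.1 _) (hp i).le
          _ = M := hsum
      · exact hM
    · intro i y hy
      have hpi : p i ≤ 1 := by
        rw [← hp1]; exact Finset.single_le_sum (fun j _ => (hp j).le) (Finset.mem_univ i)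
      change (if y ∈ K then ∑ i, p i * Q f p K (n + m) (f i y) else 0) ≤ _
      split_ifs
      · have h1 := ih.2 i (f i y) (by simpa using hy)
        have h2 : ∑ j, p j * Q f p K (n + m) (f j y)
            ≤ ∑ j, (p j * M - if j = i then p i * (M * p i ^ m) else 0) := by
          refine Finset.sum_le_sum fun j _ => ?_
          split_ifs with h
          · subst h
            have := mul_le_mul_of_nonneg_left h1 (hp j).le
            linarith
          · have := mul_le_mul_of_nonneg_left (ih.1 (f j y)) (hp j).le
            linarith
        rw [Finset.sum_sub_distrib, hsum] at h2
        simp only [Finset.sum_ite_eq', Finset.mem_univ, if_true] at h2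
        rw [pow_succ]; linarith
      · exact mul_nonneg hM (sub_nonneg.2 (pow_le_one₀ (hp i).le hpi))

lemma Q_decay (f : Fin (s + 1) → ℝ → ℝ) (p : Fin (s + 1) → ℝ) (hp : ∀ i, 0 < p i)
    (hp1 : ∑ i, p i = 1) (K : Set ℝ) (N : ℕ)
    (hN : ∀ y, ∃ i, (f i)^[N] y ∉ K) :
    ∃ r : ℝ, 0 ≤ r ∧ r < 1 ∧ ∀ k y, Q f p K (k * N) y ≤ r ^ k := by
  have hpi : ∀ i, p i ≤ 1 := fun i => by
    rw [← hp1]; exact Finset.single_le_sum (fun j _ => (hp j).le) (Finset.mem_univ i)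
  obtain ⟨i₀, hi₀⟩ := Finite.exists_min p
  have hc : 0 < p i₀ ^ N := pow_pos (hp _) _
  have hc1 : p i₀ ^ N ≤ 1 := pow_le_one₀ (hp _).le (hpi _)
  refine ⟨1 - p i₀ ^ N, by linarith, by linarith, ?_⟩
  intro k
  induction k with
  | zero => intro y; simp only [zero_mul, Q, pow_zero]; split_ifs <;> norm_num
  | succ k ih =>
    intro y
    obtain ⟨i, hi⟩ := hN y
    have hnn : 0 ≤ (1 - p i₀ ^ N) ^ k := pow_nonneg (by linarith) _
    have := (Q_step f p hp hp1 K (k * N) _ hnn ih N).2 i y hi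
    rw [Nat.succ_mul, pow_succ]
    refine this.trans (mul_le_mul_of_nonneg_left ?_ hnn)
    have := pow_le_pow_left₀ (hp i₀).le (hi₀ i) N
    linarith

lemma expand (S : RDS s) (i : Fin (s + 1)) {x y : ℝ} (h : x ≤ y) :
    S.lam * (y - x) ≤ S.f i y - S.f i x :=
  mul_sub_le_image_sub_of_le_deriv ((S.smooth i).differentiable (by norm_num))
    (S.expanding i) h

lemma exists_fix (S : RDS s) (i : Fin (s + 1)) : ∃ x, S.f i x = x := by
  have hl : 0 < S.lam - 1 := sub_pos.2 S.hlam
  set X := |S.f i 0| / (S.lam - 1) with hX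
  have hX0 : 0 ≤ X := by positivity
  have hXm : (S.lam - 1) * X = |S.f i 0| := by rw [hX]; field_simp
  have h1 := expand S i hX0
  have h2 := expand S i (x := -X) (y := 0) (by linarith)
  have hc : Continuous fun x => S.f i x - x := (S.smooth i).continuous.sub continuous_id
  have := intermediate_value_Icc (a := -X) (b := X) (by linarith) hc.continuousOn
  obtain ⟨x, -, hx⟩ := this (show (0 : ℝ) ∈ Icc _ _ from
    ⟨by have := le_abs_self (S.f i 0); nlinarith,
     by have := neg_abs_le (S.f i 0); nlinarith⟩)
  exact ⟨x, by dsimp only at hx; linarith⟩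

lemma iter_up (S : RDS s) (i : Fin (s + 1)) {a : ℝ} (ha : S.f i a = a) (n : ℕ) :
    ∀ {y : ℝ}, a ≤ y → S.lam ^ n * (y - a) ≤ (S.f i)^[n] y - a := by
  induction n with
  | zero => intro y h; simp
  | succ n ih =>
    intro y h
    have h1 := expand S i h
    rw [ha] at h1
    have hl := S.hlam
    have h0 : 0 ≤ S.lam * (y - a) := mul_nonneg (by linarith) (by linarith)
    have h2 := ih (y := S.f i y) (by linarith)
    rw [Function.iterate_succ_apply]
    refine le_trans ?_ h2
    rw [pow_succ, mul_assoc]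
    exact mul_le_mul_of_nonneg_left h1 (by positivity)

lemma iter_down (S : RDS s) (i : Fin (s + 1)) {a : ℝ} (ha : S.f i a = a) (n : ℕ) :
    ∀ {y : ℝ}, y ≤ a → S.lam ^ n * (a - y) ≤ a - (S.f i)^[n] y := by
  induction n with
  | zero => intro y h; simp
  | succ n ih =>
    intro y h
    have h1 := expand S i h
    rw [ha] at h1
    have hl := S.hlam
    have h0 : 0 ≤ S.lam * (a - y) := mul_nonneg (by linarith) (by linarith)
    have h2 := ih (y := S.f i y) (by linarith)
    rw [Function.iterate_succ_apply]
    refine le_trans ?_ h2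
    rw [pow_succ, mul_assoc]
    exact mul_le_mul_of_nonneg_left h1 (by positivity)

lemma escape (S : RDS s) (R : ℝ) :
    ∃ N, ∀ y, ∃ i, (S.f i)^[N + 1] y ∉ Icc (-R) R := by
  choose a ha using exists_fix S
  have : ∃ i j, a i < a j := by
    by_contra! h
    exact S.noCommonFix ⟨a 0, fun i => by
      have : a i = a 0 := le_antisymm (h 0 i) (h i 0)
      rw [← this]; exact ha i⟩
  obtain ⟨i, j, hij⟩ := this
  set δ := (a j - a i) / 2 with hδ
  have hδ0 : 0 < δ := by rw [hδ]; linarith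
  obtain ⟨N, hN⟩ := pow_unbounded_of_one_lt ((|R| + |a i| + |a j|) / δ) S.hlam
  have hl := S.hlam
  have hN1 : |R| + |a i| + |a j| < S.lam ^ (N + 1) * δ := by
    rw [div_lt_iff₀ hδ0] at hN
    refine hN.trans_le (mul_le_mul_of_nonneg_right ?_ hδ0.le)
    exact pow_le_pow_right₀ hl.le (Nat.le_succ _)
  have hpos : 0 ≤ S.lam ^ (N + 1) := by positivity
  have e1 := le_abs_self R
  have e2 := neg_abs_le (a i)
  have e3 := le_abs_self (a j)
  have e4 := abs_nonneg (a i)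
  have e5 := abs_nonneg (a j)
  refine ⟨N, fun y => ?_⟩
  rcases le_total (a i + δ) y with h | h
  · refine ⟨i, fun hm => ?_⟩
    have h1 := iter_up S i (ha i) (N + 1) (y := y) (by linarith)
    have h2 := mul_le_mul_of_nonneg_left (show δ ≤ y - a i by linarith) hpos
    have := hm.2
    linarith
  · refine ⟨j, fun hm => ?_⟩
    have h1 := iter_down S j (ha j) (N + 1) (y := y) (by linarith)
    have h2 := mul_le_mul_of_nonneg_left (show δ ≤ a j - y by linarith) hpos
    have := hm.1
    linarith

/-- A radius beyond which everything is in `V` and moves towards infinity. -/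
lemma exists_R (S : RDS s) (x : ℝ) : ∃ R : ℝ, |x| ≤ R ∧
    Ioi (R : EReal) ⊆ S.Vp ∧ Iio ((-R : ℝ) : EReal) ⊆ S.Vm ∧
    (∀ i, ∀ y, R < y → R < S.f i y) ∧ (∀ i, ∀ y, y < -R → S.f i y < -R) := by
  choose a ha using exists_fix S
  obtain ⟨b, hb⟩ := EReal.mem_nhds_top_iff.1 S.hVp
  obtain ⟨c, hc⟩ := EReal.mem_nhds_bot_iff.1 S.hVm
  have hA : ∀ i, |a i| ≤ ∑ j, |a j| := fun i =>
    Finset.single_le_sum (f := fun j => |a j|) (fun j _ => abs_nonneg _) (Finset.mem_univ i)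
  have hA0 : 0 ≤ ∑ j, |a j| := Finset.sum_nonneg fun j _ => abs_nonneg _
  have hx := abs_nonneg x
  have hb0 := abs_nonneg b
  have hc0 := abs_nonneg c
  have hb1 := le_abs_self b
  have hc1 := neg_abs_le c
  have hl := S.hlam
  refine ⟨|x| + |b| + |c| + ∑ j, |a j|, by linarith, ?_, ?_, ?_, ?_⟩
  · refine (Ioi_subset_Ioi ?_).trans hb
    exact EReal.coe_le_coe_iff.2 (by linarith)
  · refine (Iio_subset_Iio ?_).trans hc
    exact EReal.coe_le_coe_iff.2 (by linarith)
  · intro i y hy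
    have h1 := hA i
    have h2 := le_abs_self (a i)
    have h3 := expand S i (x := a i) (y := y) (by linarith)
    rw [ha] at h3
    nlinarith
  · intro i y hy
    have h1 := hA i
    have h2 := neg_abs_le (a i)
    have h3 := expand S i (x := y) (y := a i) (by linarith)
    rw [ha] at h3
    nlinarith

lemma d_nonneg (S : RDS s) (x y : EReal) : 0 ≤ S.d x y := by
  have h := S.d_triangle x y x
  rw [(S.d_eq_zero x x).2 rfl, S.d_comm y x] at h
  linarith

/-- A forward-invariant set on which the generators do not increase `d` is equicontinuous. -/
lemma equicont_of (S : RDS s) (U : Set EReal)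
    (hU : ∀ i, ∀ x ∈ U, extE (S.f i) x ∈ U)
    (hd : ∀ i, ∀ x ∈ U, ∀ y ∈ U, S.d (extE (S.f i) x) (extE (S.f i) y) ≤ S.d x y) :
    EquicontG S U := by
  have key : ∀ w : List (Fin (s + 1)), ∀ x ∈ U, ∀ y ∈ U,
      S.d (applyWord S w x) (applyWord S w y) ≤ S.d x y := by
    intro w
    induction w with
    | nil => intro x _ y _; exact le_rfl
    | cons i w ih =>
      intro x hx y hy
      exact (ih _ (hU i x hx) _ (hU i y hy)).trans (hd i x hx y hy)
  exact fun x hx ε hε => ⟨ε, hε, fun y hy h w _ => (key w x hx y hy).trans_lt h⟩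

lemma contr (S : RDS s) (i : Fin (s + 1)) :
    (∀ x ∈ S.Vp, ∀ y ∈ S.Vp, S.d (extE (S.f i) x) (extE (S.f i) y) ≤ S.d x y) ∧
    (∀ x ∈ S.Vm, ∀ y ∈ S.Vm, S.d (extE (S.f i) x) (extE (S.f i) y) ≤ S.d x y) := by
  obtain ⟨c, hc, h1, h2⟩ := S.contracting i
  have : ∀ x y, c * S.d x y ≤ S.d x y := fun x y => by
    have := d_nonneg S x y
    nlinarith
  exact ⟨fun x hx y hy => (h1 x hx y hy).trans (this x y),
    fun x hx y hy => (h2 x hx y hy).trans (this x y)⟩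

lemma not_julia (S : RDS s) (x₀ : ℝ) : ∃ R : ℝ, |x₀| ≤ R ∧
    (∀ x : EReal, (R : EReal) < x → x ∉ Julia S) ∧
    (∀ x : EReal, x < ((-R : ℝ) : EReal) → x ∉ Julia S) := by
  obtain ⟨R, h0, h1, h2, h3, h4⟩ := exists_R S x₀
  refine ⟨R, h0, fun x hx hJ => hJ ⟨Ioi (R : EReal), Ioi_mem_nhds hx, ?_⟩,
    fun x hx hJ => hJ ⟨Iio ((-R : ℝ) : EReal), Iio_mem_nhds hx, ?_⟩⟩
  · refine equicont_of S _ (fun i y hy => ?_)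
      fun i y hy z hz => (contr S i).1 y (h1 hy) z (h1 hz)
    induction y with
    | bot => simp at hy
    | top => simp [extE]
    | coe y =>
      rw [extE_coe]
      exact EReal.coe_lt_coe_iff.2 (h3 i y (EReal.coe_lt_coe_iff.1 hy))
  · refine equicont_of S _ (fun i y hy => ?_)
      fun i y hy z hz => (contr S i).2 y (h2 hy) z (h2 hz)
    induction y with
    | top => simp at hy
    | bot => simp only [extE, if_true]; exact EReal.bot_lt_coe _
    | coe y =>
      rw [extE_coe]
      exact EReal.coe_lt_coe_iff.2 (h4 i y (EReal.coe_lt_coe_iff.1 hy))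

lemma applyWord_replicate (S : RDS s) (i : Fin (s + 1)) (n : ℕ) : ∀ x : ℝ,
    applyWord S (List.replicate n i) (x : EReal) = (((S.f i)^[n] x : ℝ) : EReal) := by
  induction n with
  | zero => intro x; rfl
  | succ n ih =>
    intro x
    rw [List.replicate_succ, Function.iterate_succ_apply, ← ih]
    change applyWord S _ (extE (S.f i) x) = _
    rw [extE_coe]

lemma pfull_pos (p : Fin s → ℝ) (hp : ProbVec p) (i : Fin (s + 1)) : 0 < pfull p i := by
  unfold pfull
  split_ifs with h
  · exact (hp.1 _).1
  · linarith [hp.2]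

lemma pfull_sum (p : Fin s → ℝ) : ∑ i, pfull p i = 1 := by
  rw [Fin.sum_univ_castSucc]
  simp [pfull]

end KJ

/-- **Proposition (empty kernel Julia set, Proposition 2.1).**
The kernel Julia set `J_ker = ⋂_{g ∈ G} g⁻¹(J)` is empty; moreover for each `x ∈ ℝ` one
has `μ_p⃗ {ω ∈ Σ ∣ x ∈ J_ω} = 0`. -/
theorem kernel_julia_empty {s : ℕ} (S : RDS s) :
    (⋂ w : {w : List (Fin (s + 1)) // w ≠ []},
        RDS.applyWord S w.1 ⁻¹' RDS.Julia S) = ∅ ∧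
    (∀ p : Fin s → ℝ, ProbVec p → ∀ μ : Measure (Word s), IsBernoulli (pfull p) μ →
      ∀ x : ℝ, μ {ω : Word s | (x : EReal) ∈ RDS.codingSet S ω} = 0) := by
  refine ⟨?_, ?_⟩
  · rw [Set.eq_empty_iff_forall_notMem]
    intro x hx
    rw [mem_iInter] at hx
    obtain ⟨R, -, hp, hm⟩ := KJ.not_julia S 0
    induction x with
    | top =>
      have := hx ⟨[0], by simp⟩
      refine hp ⊤ (EReal.coe_lt_top _) ?_
      simpa [RDS.applyWord, extE] using this
    | bot =>
      have := hx ⟨[0], by simp⟩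
      refine hm ⊥ (EReal.bot_lt_coe _) ?_
      simpa [RDS.applyWord, extE] using this
    | coe x =>
      obtain ⟨N, hN⟩ := KJ.escape S R
      obtain ⟨i, hi⟩ := hN x
      have := hx ⟨List.replicate (N + 1) i, by simp⟩
      rw [mem_preimage, KJ.applyWord_replicate] at this
      rw [mem_Icc, not_and_or, not_le, not_le] at hi
      rcases hi with hi | hi
      · exact hm _ (EReal.coe_lt_coe_iff.2 hi) this
      · exact hp _ (EReal.coe_lt_coe_iff.2 hi) this
  · intro p hp μ hμ x
    obtain ⟨R, h0, h1, h2, -, -⟩ := KJ.exists_R S x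
    obtain ⟨N, hN⟩ := KJ.escape S R
    obtain ⟨r, hr0, hr1, hr⟩ := KJ.Q_decay S.f (pfull p) (KJ.pfull_pos p hp) (KJ.pfull_sum p)
      (Icc (-R) R) (N + 1) hN
    have hsub : {ω : Word s | (x : EReal) ∈ RDS.codingSet S ω} ⊆
        {ω | ∀ k, RDS.itR S ω k x ∈ Icc (-R) R} := by
      intro ω hω k
      cases k with
      | zero => exact abs_le.1 h0
      | succ k =>
        have := mem_iInter.1 hω k
        rw [mem_preimage, KJ.itE_coe] at this
        by_contra hi
        rw [mem_Icc, not_and_or, not_le, not_le] at hi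
        rcases hi with hi | hi
        · exact this (Or.inr (h2 (EReal.coe_lt_coe_iff.2 hi)))
        · exact this (Or.inl (h1 (EReal.coe_lt_coe_iff.2 hi)))
    have hle : ∀ k : ℕ, μ {ω : Word s | (x : EReal) ∈ RDS.codingSet S ω} ≤
        ENNReal.ofReal (r ^ k) := fun k =>
      (measure_mono hsub).trans ((KJ.measure_le S _ (KJ.pfull_pos p hp) μ hμ _ _ x).trans
        (ENNReal.ofReal_le_ofReal (hr k x)))
    have ht : Tendsto (fun k : ℕ => ENNReal.ofReal (r ^ k)) atTop (nhds 0) := by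
      have := ENNReal.tendsto_ofReal (tendsto_pow_atTop_nhds_zero_of_lt_one hr0 hr1)
      simpa using this
    exact le_antisymm (ge_of_tendsto' ht hle) zero_le
end

section
/- The map p⃗ ↦ α_-(p⃗) is lower semi-continuous on {p⃗ ∈ (0,1)^s : Σ_{i≤s} p_i < 1}. -/
open MeasureTheory Filter Topology Set

theorem phi_le_aux {s : ℕ} (S : RDS s) (ω : Word s) : RDS.phi S ω ≤ - Real.log S.lam := by
  unfold RDS.phi
  have h1 := S.expanding (ω 0) (RDS.cmapR S ω)
  have h2 := S.hlam
  have h3 : S.lam ≤ |deriv (S.f (ω 0)) (RDS.cmapR S ω)| := h1.trans (le_abs_self _)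
  have := Real.log_le_log (by linarith) h3
  linarith

theorem birk_phi_le_aux {s : ℕ} (S : RDS s) (ω : Word s) (n : ℕ) :
    RDS.birk (RDS.phi S) n ω ≤ - (n * Real.log S.lam) := by
  unfold RDS.birk
  have := Finset.sum_le_card_nsmul (Finset.range n)
    (fun k => RDS.phi S (fun m => ω (m + k))) (- Real.log S.lam)
    (fun k _ => phi_le_aux S _)
  simp only [Finset.card_range, nsmul_eq_mul] at this
  linarith

theorem birk_psi_aux {s : ℕ} (p q : Fin (s + 1) → ℝ) (δ : ℝ)
    (h : ∀ i, Real.log (q i) ≤ Real.log (p i) + δ) (ω : Word s) (n : ℕ) :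
    RDS.birk (RDS.psiP q) n ω ≤ RDS.birk (RDS.psiP p) n ω + n * δ := by
  unfold RDS.birk RDS.psiP
  have : (n : ℝ) * δ = ∑ k ∈ Finset.range n, δ := by simp
  rw [this, ← Finset.sum_add_distrib]
  exact Finset.sum_le_sum fun k _ => h _

theorem ratio_aux {s : ℕ} (S : RDS s) (p q : Fin (s + 1) → ℝ) (δ : ℝ) (hδ : 0 ≤ δ)
    (h : ∀ i, Real.log (q i) ≤ Real.log (p i) + δ) (ω : Word s) (n : ℕ) :
    RDS.birk (RDS.psiP p) n ω / RDS.birk (RDS.phi S) n ω - δ / Real.log S.lam ≤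
      RDS.birk (RDS.psiP q) n ω / RDS.birk (RDS.phi S) n ω := by
  have hl : 0 < Real.log S.lam := Real.log_pos S.hlam
  have hb := birk_psi_aux p q δ h ω n
  have hp := birk_phi_le_aux S ω n
  set A := RDS.birk (RDS.psiP p) n ω
  set B := RDS.birk (RDS.psiP q) n ω
  set D := RDS.birk (RDS.phi S) n ω
  have hd : 0 ≤ δ / Real.log S.lam := by positivity
  rcases eq_or_lt_of_le (show D ≤ 0 by
    have : 0 ≤ (n : ℝ) * Real.log S.lam := by positivity
    linarith) with h0 | h0
  · rw [h0]; simpa using hd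
  · rw [sub_le_iff_le_add, div_le_iff_of_neg h0, add_mul, div_mul_cancel₀ _ h0.ne]
    have e : (n : ℝ) * δ = δ / Real.log S.lam * (n * Real.log S.lam) := by field_simp
    nlinarith [mul_le_mul_of_nonneg_left hp hd]

theorem ratio_bdd_aux {s : ℕ} (S : RDS s) (p : Fin (s + 1) → ℝ)
    (h0 : ∀ i, 0 < p i) (h1 : ∀ i, p i ≤ 1) : ∃ M : ℝ, ∀ (ω : Word s) (n : ℕ),
    0 ≤ RDS.birk (RDS.psiP p) n ω / RDS.birk (RDS.phi S) n ω ∧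
    RDS.birk (RDS.psiP p) n ω / RDS.birk (RDS.phi S) n ω ≤ M := by
  have hl : ∀ i, Real.log (p i) ≤ 0 := fun i => Real.log_nonpos (h0 i).le (h1 i)
  have hs : ∀ i, - ∑ j, - Real.log (p j) ≤ Real.log (p i) := fun i => by
    have := Finset.single_le_sum (f := fun j => - Real.log (p j))
      (fun j _ => neg_nonneg.2 (hl j)) (Finset.mem_univ i)
    linarith
  have hK : 0 ≤ ∑ j, - Real.log (p j) := Finset.sum_nonneg fun j _ => neg_nonneg.2 (hl j)
  have z : ∀ (ω : Word s) (n : ℕ), RDS.birk (RDS.psiP (fun _ : Fin (s+1) => (1:ℝ))) n ω = 0 := by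
    intro ω n; simp [RDS.birk, RDS.psiP]
  refine ⟨(∑ j, - Real.log (p j)) / Real.log S.lam, fun ω n => ⟨?_, ?_⟩⟩
  · have := ratio_aux S (fun _ => 1) p 0 le_rfl (by simpa using hl) ω n
    simpa [z] using this
  · have := ratio_aux S p (fun _ => 1) _ hK (fun i => by
      have := hs i
      simp only [Real.log_one]; linarith) ω n
    rw [z] at this
    simp only [zero_div] at this
    linarith

theorem alpha_aux {s : ℕ} (S : RDS s) (p q : Fin (s + 1) → ℝ)
    (hp0 : ∀ i, 0 < p i) (hp1 : ∀ i, p i ≤ 1) (hq0 : ∀ i, 0 < q i) (hq1 : ∀ i, q i ≤ 1)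
    (δ : ℝ) (hδ : 0 ≤ δ) (h : ∀ i, Real.log (q i) ≤ Real.log (p i) + δ) :
    RDS.alphaMinus S p - δ / Real.log S.lam ≤ RDS.alphaMinus S q := by
  obtain ⟨M, hM⟩ := ratio_bdd_aux S p hp0 hp1
  obtain ⟨N, hN⟩ := ratio_bdd_aux S q hq0 hq1
  have ub : ∀ ω : Word s, IsCoboundedUnder (· ≥ ·) atTop
      (fun n => RDS.birk (RDS.psiP p) n ω / RDS.birk (RDS.phi S) n ω) := fun ω =>
    (isBoundedUnder_of ⟨M, fun n => (hM ω n).2⟩ : IsBoundedUnder (· ≤ ·) atTop _).isCoboundedUnder_ge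
  have uq : ∀ ω : Word s, IsCoboundedUnder (· ≥ ·) atTop
      (fun n => RDS.birk (RDS.psiP q) n ω / RDS.birk (RDS.phi S) n ω) := fun ω =>
    (isBoundedUnder_of ⟨N, fun n => (hN ω n).2⟩ : IsBoundedUnder (· ≤ ·) atTop _).isCoboundedUnder_ge
  unfold RDS.alphaMinus
  refine le_ciInf fun ω => ?_
  have hinf : (⨅ ω : Word s, Filter.liminf
      (fun n => RDS.birk (RDS.psiP p) n ω / RDS.birk (RDS.phi S) n ω) atTop) ≤
      Filter.liminf (fun n => RDS.birk (RDS.psiP p) n ω / RDS.birk (RDS.phi S) n ω) atTop := by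
    refine ciInf_le ⟨0, ?_⟩ ω
    rintro _ ⟨τ, rfl⟩
    exact le_liminf_of_le (ub τ) (Eventually.of_forall fun n => (hM τ n).1)
  refine le_of_forall_lt fun c hc => ?_
  obtain ⟨c', hc1, hc2⟩ := exists_between hc
  refine hc1.trans_le (le_liminf_of_le (uq ω) ?_)
  have : c' + δ / Real.log S.lam <
      Filter.liminf (fun n => RDS.birk (RDS.psiP p) n ω / RDS.birk (RDS.phi S) n ω) atTop := by
    linarith
  filter_upwards [eventually_lt_of_lt_liminf this (isBoundedUnder_of ⟨0, fun n => (hM ω n).1⟩)]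
    with n hn
  have := ratio_aux S p q δ hδ h ω n
  linarith

theorem pfull_pos_aux {s : ℕ} {p : Fin s → ℝ} (hp : ProbVec p) (i : Fin (s + 1)) :
    0 < pfull p i ∧ pfull p i ≤ 1 := by
  unfold pfull
  split_ifs with h
  · exact ⟨(hp.1 _).1, (hp.1 _).2.le⟩
  · have := Finset.sum_nonneg (s := Finset.univ) fun j _ => (hp.1 j).1.le
    exact ⟨by linarith [hp.2], by linarith⟩

theorem pfull_cont_aux {s : ℕ} (i : Fin (s + 1)) :
    Continuous (fun p : Fin s → ℝ => pfull p i) := by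
  unfold pfull
  split_ifs with h <;> fun_prop

/-- **Lemma (lower semicontinuity of `α_-`, Lemma 2.10).**
The map `p⃗ ↦ α_-(p⃗)` is lower semi-continuous on `{p⃗ ∈ (0,1)^s ∣ ∑ p_i < 1}`. -/
theorem alphaMinus_lowerSemicontinuous {s : ℕ} (S : RDS s) :
    LowerSemicontinuousOn (fun p : Fin s → ℝ => RDS.alphaMinus S (pfull p))
      {p : Fin s → ℝ | ProbVec p} := by
  intro p hp y hy
  have hl : 0 < Real.log S.lam := Real.log_pos S.hlam
  simp only at hy
  set δ := (RDS.alphaMinus S (pfull p) - y) / 2 * Real.log S.lam with hδd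
  have hδ : 0 < δ := mul_pos (by linarith) hl
  have hev : ∀ᶠ q in 𝓝 p, ∀ i, Real.log (pfull q i) < Real.log (pfull p i) + δ := by
    rw [eventually_all]
    intro i
    have hc : ContinuousAt (fun q : Fin s → ℝ => Real.log (pfull q i)) p :=
      (pfull_cont_aux i).continuousAt.log (pfull_pos_aux hp i).1.ne'
    exact hc.eventually_lt_const (by linarith)
  filter_upwards [nhdsWithin_le_nhds hev, self_mem_nhdsWithin] with q hq hqs
  have := alpha_aux S (pfull p) (pfull q) (fun i => (pfull_pos_aux hp i).1)
    (fun i => (pfull_pos_aux hp i).2) (fun i => (pfull_pos_aux hqs i).1)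
    (fun i => (pfull_pos_aux hqs i).2) δ hδ.le (fun i => (hq i).le)
  have e : δ / Real.log S.lam = (RDS.alphaMinus S (pfull p) - y) / 2 := by
    rw [hδd]; field_simp
  rw [e] at this
  linarith
end

section
/- There exists η < 1 such that for every compact set K ⊂ ℝ̄∖J there exists a constant C_K < ∞ such that for all x, y ∈ K belonging to the same connected component of ℝ̄∖J, and for every finite word ω ∈ I^*, one has d(f_ω(x), f_ω(y)) ≤ C_K·η^{|ω|}·d(x,y). -/
open MeasureTheory Filter Topology Set

namespace RDS

variable {s : ℕ}

lemma aux_dself (S : RDS s) (x : EReal) : S.d x x = 0 := (S.d_eq_zero x x).2 rfl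

lemma aux_dnn (S : RDS s) (x y : EReal) : 0 ≤ S.d x y := by
  have h := S.d_triangle x y x
  rw [aux_dself, S.d_comm y x] at h
  linarith

lemma aux_dpos (S : RDS s) {x y : EReal} (h : x ≠ y) : 0 < S.d x y :=
  lt_of_le_of_ne (aux_dnn S x y) (fun h' => h ((S.d_eq_zero x y).1 h'.symm))

lemma aux_ball (S : RDS s) (x : EReal) {ε : ℝ} (hε : 0 < ε) : {y | S.d x y < ε} ∈ 𝓝 x := by
  refine IsOpen.mem_nhds ((S.d_top _).2 ?_) ?_
  · intro y hy
    refine ⟨ε - S.d x y, sub_pos.2 hy, fun z hz => ?_⟩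
    have := S.d_triangle x y z
    show S.d x z < ε
    linarith
  · show S.d x x < ε
    rw [aux_dself]; exact hε

lemma aux_nhds (S : RDS s) {x : EReal} {U : Set EReal} (hU : U ∈ 𝓝 x) :
    ∃ ε > 0, ∀ y, S.d x y < ε → y ∈ U := by
  obtain ⟨W, hWU, hW, hxW⟩ := mem_nhds_iff.1 hU
  obtain ⟨ε, hε, h⟩ := (S.d_top W).1 hW x hxW
  exact ⟨ε, hε, fun y hy => hWU (h y hy)⟩

lemma aux_ext_coe (f : ℝ → ℝ) (x : ℝ) : extE f (x : EReal) = ((f x : ℝ) : EReal) := by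
  simp [extE]

lemma aux_ext_top (f : ℝ → ℝ) : extE f ⊤ = ⊤ := by simp [extE]

lemma aux_ext_bot (f : ℝ → ℝ) : extE f ⊥ = ⊥ := by simp [extE]

lemma aux_diff (S : RDS s) (i : Fin (s + 1)) : Differentiable ℝ (S.f i) :=
  (S.smooth i).differentiable (by norm_num)

lemma aux_exp (S : RDS s) (i : Fin (s + 1)) {a b : ℝ} (h : a ≤ b) :
    S.lam * (b - a) ≤ S.f i b - S.f i a :=
  mul_sub_le_image_sub_of_le_deriv (aux_diff S i) (S.expanding i) h

lemma aux_sm (S : RDS s) (i : Fin (s + 1)) : StrictMono (S.f i) :=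
  strictMono_of_deriv_pos fun x => by linarith [S.expanding i x, S.hlam]

lemma aux_ext_sm (S : RDS s) (i : Fin (s + 1)) : StrictMono (extE (S.f i)) := by
  intro x y hxy
  induction x with
  | bot =>
    induction y with
    | bot => exact absurd hxy (lt_irrefl _)
    | top => simp [aux_ext_bot, aux_ext_top]
    | coe y => rw [aux_ext_bot, aux_ext_coe]; exact EReal.bot_lt_coe _
  | top => exact absurd hxy not_top_lt
  | coe x =>
    induction y with
    | bot => exact absurd hxy not_lt_bot
    | top => rw [aux_ext_top, aux_ext_coe]; exact EReal.coe_lt_top _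
    | coe y =>
      rw [aux_ext_coe, aux_ext_coe]
      exact EReal.coe_lt_coe_iff.2 (aux_sm S i (EReal.coe_lt_coe_iff.1 hxy))

lemma aux_ext_surj (S : RDS s) (i : Fin (s + 1)) : Function.Surjective (extE (S.f i)) := by
  intro y
  induction y with
  | bot => exact ⟨⊥, aux_ext_bot _⟩
  | top => exact ⟨⊤, aux_ext_top _⟩
  | coe y =>
    obtain ⟨x, hx⟩ := (S.bij i).2 y
    exact ⟨x, by rw [aux_ext_coe, hx]⟩

noncomputable def auxHomeo (S : RDS s) (i : Fin (s + 1)) : EReal ≃ₜ EReal :=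
  (StrictMono.orderIsoOfSurjective _ (aux_ext_sm S i) (aux_ext_surj S i)).toHomeomorph

lemma auxHomeo_apply (S : RDS s) (i : Fin (s + 1)) (x : EReal) :
    auxHomeo S i x = extE (S.f i) x := rfl

lemma aux_image_nhds (S : RDS s) (i : Fin (s + 1)) {x : EReal} {U : Set EReal} (hU : U ∈ 𝓝 x) :
    extE (S.f i) '' U ∈ 𝓝 (extE (S.f i) x) :=
  (auxHomeo S i).isOpenMap.image_mem_nhds hU

lemma aux_cont (S : RDS s) (i : Fin (s + 1)) : Continuous (extE (S.f i)) :=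
  (auxHomeo S i).continuous

lemma aux_w_sm (S : RDS s) (w : List (Fin (s + 1))) : StrictMono (applyWord S w) := by
  induction w with
  | nil => exact strictMono_id
  | cons i w ih => exact ih.comp (aux_ext_sm S i)

lemma aux_w_surj (S : RDS s) (w : List (Fin (s + 1))) : Function.Surjective (applyWord S w) := by
  induction w with
  | nil => exact Function.surjective_id
  | cons i w ih => exact ih.comp (aux_ext_surj S i)

lemma aux_w_append (S : RDS s) (u v : List (Fin (s + 1))) (x : EReal) :
    applyWord S (u ++ v) x = applyWord S v (applyWord S u x) := by
  induction u generalizing x with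
  | nil => rfl
  | cons i u ih => exact ih _

lemma aux_w_exp (S : RDS s) (w : List (Fin (s + 1))) {a b : ℝ} (h : a ≤ b) :
    ∃ a' b' : ℝ, applyWord S w a = a' ∧ applyWord S w b = b' ∧
      S.lam ^ w.length * (b - a) ≤ b' - a' := by
  induction w generalizing a b with
  | nil => exact ⟨a, b, rfl, rfl, by simp⟩
  | cons i w ih =>
    have h1 := aux_exp S i h
    obtain ⟨a', b', ha, hb, hab⟩ := ih ((aux_sm S i).monotone h)
    refine ⟨a', b', ?_, ?_, ?_⟩
    · rw [← ha, ← aux_ext_coe]; rfl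
    · rw [← hb, ← aux_ext_coe]; rfl
    · have h2 : (0:ℝ) ≤ S.lam ^ w.length := pow_nonneg (by linarith [S.hlam]) _
      have h3 := mul_le_mul_of_nonneg_left h1 h2
      simp only [List.length_cons, pow_succ]
      linarith [mul_assoc (S.lam ^ w.length) S.lam (b - a)]

/-- Forward invariance of the Fatou set. -/
lemma aux_fwd (S : RDS s) (i : Fin (s + 1)) {x : EReal} (hx : x ∈ (Julia S)ᶜ) :
    extE (S.f i) x ∈ (Julia S)ᶜ := by
  simp only [Julia, mem_compl_iff, mem_ofPred_eq, not_not] at hx ⊢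
  obtain ⟨U, hU, hE⟩ := hx
  obtain ⟨W, hWU, hW, hxW⟩ := mem_nhds_iff.1 hU
  refine ⟨extE (S.f i) '' W, aux_image_nhds S i (hW.mem_nhds hxW), ?_⟩
  rintro _ ⟨x', hx', rfl⟩ ε hε
  obtain ⟨δ, hδ, h⟩ := hE x' (hWU hx') ε hε
  obtain ⟨δ', hδ', h'⟩ := aux_nhds S (aux_image_nhds S i (aux_ball S x' hδ))
  refine ⟨δ', hδ', ?_⟩
  rintro _ ⟨y', hy', rfl⟩ hd w _
  obtain ⟨z, hz, hzy⟩ := h' _ hd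
  have := (aux_ext_sm S i).injective hzy
  subst this
  exact h z (hWU hy') hz (i :: w) (by simp)

lemma aux_fwd_w (S : RDS s) (w : List (Fin (s + 1))) {x : EReal} (hx : x ∈ (Julia S)ᶜ) :
    applyWord S w x ∈ (Julia S)ᶜ := by
  induction w generalizing x with
  | nil => exact hx
  | cons i w ih => exact ih (aux_fwd S i hx)

lemma aux_fatou_open (S : RDS s) : IsOpen (Julia S)ᶜ := by
  rw [isOpen_iff_mem_nhds]
  intro x hx
  simp only [Julia, mem_compl_iff, mem_ofPred_eq, not_not] at hx
  obtain ⟨U, hU, hE⟩ := hx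
  filter_upwards [interior_mem_nhds.2 hU] with y hy
  simp only [Julia, mem_compl_iff, mem_ofPred_eq, not_not]
  exact ⟨U, mem_interior_iff_mem_nhds.1 hy, hE⟩

/-- Points far out move outwards. -/
lemma aux_far (S : RDS s) : ∃ B : ℝ, 0 < B ∧ (∀ i, ∀ x : ℝ, B ≤ x → x ≤ S.f i x) ∧
    (∀ i, ∀ x : ℝ, x ≤ -B → S.f i x ≤ x) := by
  have hl := S.hlam
  refine ⟨(1 + ∑ i, |S.f i 0|) / (S.lam - 1), ?_, ?_, ?_⟩
  · have : 0 ≤ ∑ i, |S.f i 0| := Finset.sum_nonneg fun i _ => abs_nonneg _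
    apply div_pos <;> linarith
  all_goals
    intro i x hx
    have h0 : |S.f i 0| ≤ ∑ i, |S.f i 0| :=
      Finset.single_le_sum (f := fun i => |S.f i 0|) (fun i _ => abs_nonneg _) (Finset.mem_univ i)
    have h00 : 0 ≤ |S.f i 0| := abs_nonneg _
  · rw [div_le_iff₀ (by linarith)] at hx
    have hx0 : 0 ≤ x := by
      by_contra hc
      push Not at hc
      nlinarith
    have := aux_exp S i hx0
    have := neg_abs_le (S.f i 0)
    nlinarith
  · have hx' : (1 + ∑ i, |S.f i 0|) / (S.lam - 1) ≤ -x := by linarith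
    rw [div_le_iff₀ (by linarith)] at hx'
    have hx0 : x ≤ 0 := by
      by_contra hc
      push Not at hc
      nlinarith
    have := aux_exp S i hx0
    have := le_abs_self (S.f i 0)
    nlinarith

/-- A fixed point exists and belongs to the Julia set. -/
lemma aux_fix (S : RDS s) : ∃ p : ℝ, (p : EReal) ∈ Julia S := by
  obtain ⟨B, hB, h1, h2⟩ := aux_far S
  have hc : ContinuousOn (fun x => S.f 0 x - x) (Icc (-B) B) :=
    ((aux_diff S 0).continuous.sub continuous_id).continuousOn
  have h3 := h1 0 B le_rfl
  have h4 := h2 0 (-B) le_rfl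
  obtain ⟨p, -, hp⟩ := intermediate_value_Icc (by linarith) hc
    (show (0:ℝ) ∈ Icc _ _ from ⟨by linarith, by linarith⟩)
  have hp : S.f 0 p = p := by
    have : S.f 0 p - p = 0 := hp
    linarith
  refine ⟨p, ?_⟩
  rintro ⟨U, hU, hE⟩
  have hO : Iio ((p + 1 : ℝ) : EReal) ∈ 𝓝 (p : EReal) :=
    Iio_mem_nhds (EReal.coe_lt_coe_iff.2 (by linarith))
  obtain ⟨ε, hε, hεO⟩ := aux_nhds S hO
  obtain ⟨δ, hδ, h⟩ := hE p (mem_of_mem_nhds hU) ε hε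
  have hN := inter_mem hU (aux_ball S p hδ)
  rw [EReal.nhds_coe, mem_map] at hN
  obtain ⟨r, hr, hball⟩ := Metric.mem_nhds_iff.1 hN
  have hy : p + r / 2 ∈ Metric.ball p r := by
    rw [Metric.mem_ball, Real.dist_eq, abs_lt]
    constructor <;> linarith
  obtain ⟨hyU, hyd⟩ := hball hy
  obtain ⟨n, hn⟩ := pow_unbounded_of_one_lt (2 / r) S.hlam
  have hfix : ∀ n, applyWord S (List.replicate n 0) (p : EReal) = p := by
    intro n
    induction n with
    | zero => rfl
    | succ n ih =>
      rw [List.replicate_succ, applyWord, aux_ext_coe, hp, ih]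
  obtain ⟨a', b', ha, hb, hab⟩ := aux_w_exp S (List.replicate (n+1) 0)
    (show p ≤ p + r / 2 by linarith)
  have hlt := h _ hyU hyd (List.replicate (n+1) 0) (by simp)
  rw [hfix] at hlt ha
  have hmem := hεO _ hlt
  rw [hb] at hmem
  have hb' : b' < p + 1 := EReal.coe_lt_coe_iff.1 hmem
  have ha' : p = a' := EReal.coe_eq_coe_iff.1 ha
  rw [List.length_replicate, pow_succ] at hab
  have hl := S.hlam
  have : 1 < S.lam ^ n * (r / 2) := by
    rw [div_lt_iff₀ hr] at hn; linarith
  have h5 : S.lam ^ n * S.lam * (p + r / 2 - p) = S.lam * (S.lam ^ n * (r/2)) := by ring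
  nlinarith

lemma aux_dbdd (S : RDS s) : ∃ D : ℝ, 0 ≤ D ∧ ∀ x y, S.d x y ≤ D := by
  have h : ∃ D : ℝ, ∀ x ∈ (univ : Set EReal), S.d ⊥ x ≤ D := by
    refine isCompact_univ.induction_on (p := fun t => ∃ D : ℝ, ∀ x ∈ t, S.d ⊥ x ≤ D) ?_ ?_ ?_ ?_
    · exact ⟨0, by simp⟩
    · rintro a b hab ⟨D, h⟩
      exact ⟨D, fun x hx => h x (hab hx)⟩
    · rintro a b ⟨D, h⟩ ⟨D', h'⟩
      refine ⟨max D D', ?_⟩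
      rintro x (hx | hx)
      · exact (h x hx).trans (le_max_left _ _)
      · exact (h' x hx).trans (le_max_right _ _)
    · intro x _
      refine ⟨_, mem_nhdsWithin_of_mem_nhds (aux_ball S x one_pos), S.d ⊥ x + 1, fun y hy => ?_⟩
      have := S.d_triangle ⊥ x y
      have : S.d x y < 1 := hy
      linarith
  obtain ⟨D, hD⟩ := h
  have h0 : 0 ≤ D := (aux_dnn S ⊥ ⊥).trans (hD _ trivial)
  refine ⟨D + D, by linarith, fun x y => ?_⟩
  have := S.d_triangle x ⊥ y
  rw [S.d_comm x ⊥] at this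
  linarith [hD x trivial, hD y trivial]

lemma aux_locLip (S : RDS s) (i : Fin (s + 1)) (x : EReal) :
    ∃ U ∈ 𝓝 x, ∃ L : ℝ, ∀ a ∈ U, ∀ b ∈ U,
      S.d (extE (S.f i) a) (extE (S.f i) b) ≤ L * S.d a b := by
  obtain ⟨c, _, hp, hm⟩ := S.contracting i
  induction x with
  | bot => exact ⟨_, S.hVm, c, hm⟩
  | top => exact ⟨_, S.hVp, c, hp⟩
  | coe x =>
    obtain ⟨K, t, ht, hK⟩ := (S.smooth i).locallyLipschitz x
    obtain ⟨r, hr, hrt⟩ := Metric.mem_nhds_iff.1 ht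
    obtain ⟨C1, hC1, h1⟩ := S.d_equiv (Icc (x - r) (x + r)) isCompact_Icc
    obtain ⟨C2, hC2, h2⟩ := S.d_equiv (Icc (S.f i (x - r)) (S.f i (x + r))) isCompact_Icc
    refine ⟨(fun y : ℝ => (y : EReal)) '' Metric.ball x r, ?_, C2 * (K * C1), ?_⟩
    · rw [EReal.nhds_coe]
      exact image_mem_map (Metric.ball_mem_nhds x hr)
    · rintro _ ⟨a, ha, rfl⟩ _ ⟨b, hb, rfl⟩
      simp only [aux_ext_coe]
      have hL := hK.dist_le_mul a (hrt ha) b (hrt hb)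
      rw [Real.dist_eq, Real.dist_eq] at hL
      have key : ∀ a ∈ Metric.ball x r, a ∈ Icc (x - r) (x + r) := by
        intro a ha
        rw [Metric.mem_ball, Real.dist_eq, abs_lt] at ha
        constructor <;> linarith
      have key2 : ∀ a ∈ Metric.ball x r, S.f i a ∈ Icc (S.f i (x - r)) (S.f i (x + r)) :=
        fun a ha => ⟨(aux_sm S i).monotone (key a ha).1, (aux_sm S i).monotone (key a ha).2⟩
      have e1 := (h1 a (key a ha) b (key b hb)).1
      have e2 := (h2 _ (key2 a ha) _ (key2 b hb)).2
      have e3 : |a - b| ≤ C1 * S.d a b := by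
        rwa [inv_mul_le_iff₀ hC1] at e1
      have hK0 : (0:ℝ) ≤ K := K.2
      calc _ ≤ C2 * |S.f i a - S.f i b| := e2
        _ ≤ C2 * (K * |a - b|) := by gcongr
        _ ≤ C2 * (K * (C1 * S.d a b)) := by gcongr
        _ = _ := by ring

lemma aux_lip1 (S : RDS s) (i : Fin (s + 1)) : ∃ L : ℝ, ∀ a b,
      S.d (extE (S.f i) a) (extE (S.f i) b) ≤ L * S.d a b := by
  obtain ⟨D, hD0, hD⟩ := aux_dbdd S
  have h : ∃ L : ℝ, ∀ q ∈ (univ : Set (EReal × EReal)),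
      S.d (extE (S.f i) q.1) (extE (S.f i) q.2) ≤ L * S.d q.1 q.2 := by
    refine isCompact_univ.induction_on (p := fun t : Set (EReal × EReal) => ∃ L : ℝ, ∀ q ∈ t,
      S.d (extE (S.f i) q.1) (extE (S.f i) q.2) ≤ L * S.d q.1 q.2) ?_ ?_ ?_ ?_
    · exact ⟨0, by simp⟩
    · rintro a b hab ⟨D, h⟩
      exact ⟨D, fun x hx => h x (hab hx)⟩
    · rintro a b ⟨D, h⟩ ⟨D', h'⟩
      refine ⟨max D D', ?_⟩
      rintro x (hx | hx)
      · exact (h x hx).trans (mul_le_mul_of_nonneg_right (le_max_left _ _) (aux_dnn _ _ _))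
      · exact (h' x hx).trans (mul_le_mul_of_nonneg_right (le_max_right _ _) (aux_dnn _ _ _))
    · rintro ⟨x, y⟩ _
      by_cases hxy : x = y
      · subst hxy
        obtain ⟨U, hU, L, hL⟩ := aux_locLip S i x
        exact ⟨_, mem_nhdsWithin_of_mem_nhds (prod_mem_nhds hU hU), L,
          fun q hq => hL _ hq.1 _ hq.2⟩
      · have hpos := aux_dpos S hxy
        have h4 : 0 < S.d x y / 4 := by linarith
        refine ⟨_, mem_nhdsWithin_of_mem_nhds (prod_mem_nhds (aux_ball S x h4) (aux_ball S y h4)),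
          D / (S.d x y / 2), ?_⟩
        rintro ⟨a, b⟩ ⟨ha, hb⟩
        simp only [mem_ofPred_eq] at ha hb ⊢
        have t1 := S.d_triangle x a y
        have t2 := S.d_triangle a b y
        rw [S.d_comm b y] at t2
        refine (hD _ _).trans ?_
        rw [div_mul_eq_mul_div, le_div_iff₀ (by linarith)]
        exact mul_le_mul_of_nonneg_left (by linarith) hD0
  obtain ⟨L, hL⟩ := h
  exact ⟨L, fun a b => hL (a, b) trivial⟩

lemma aux_lip (S : RDS s) : ∃ L : ℝ, 1 ≤ L ∧ ∀ i a b,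
      S.d (extE (S.f i) a) (extE (S.f i) b) ≤ L * S.d a b := by
  choose L hL using aux_lip1 S
  refine ⟨1 + ∑ i, |L i|, ?_, fun i a b => ?_⟩
  · linarith [Finset.sum_nonneg (s := Finset.univ) (f := fun i => |L i|) fun i _ => abs_nonneg _]
  · refine (hL i a b).trans (mul_le_mul_of_nonneg_right ?_ (aux_dnn _ _ _))
    have h0 : |L i| ≤ ∑ i, |L i| :=
      Finset.single_le_sum (f := fun i => |L i|) (fun i _ => abs_nonneg _) (Finset.mem_univ i)
    linarith [le_abs_self (L i)]

lemma aux_lip_w (S : RDS s) {L : ℝ} (hL1 : 1 ≤ L) (hL : ∀ i a b,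
      S.d (extE (S.f i) a) (extE (S.f i) b) ≤ L * S.d a b) (w : List (Fin (s + 1))) (a b : EReal) :
    S.d (applyWord S w a) (applyWord S w b) ≤ L ^ w.length * S.d a b := by
  induction w generalizing a b with
  | nil => simp [applyWord]
  | cons i w ih =>
    refine (ih _ _).trans ?_
    rw [List.length_cons, pow_succ, mul_assoc]
    exact mul_le_mul_of_nonneg_left (hL i a b) (by positivity)

lemma aux_eta (S : RDS s) : ∃ η : ℝ, 0 < η ∧ η < 1 ∧ ∀ i,
      (∀ x ∈ S.Vp, ∀ y ∈ S.Vp, S.d (extE (S.f i) x) (extE (S.f i) y) ≤ η * S.d x y) ∧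
      (∀ x ∈ S.Vm, ∀ y ∈ S.Vm, S.d (extE (S.f i) x) (extE (S.f i) y) ≤ η * S.d x y) := by
  choose c hc h1 h2 using S.contracting
  obtain ⟨i0, hi0⟩ := Finite.exists_max c
  refine ⟨max (c i0) (1/2), by positivity, max_lt (hc i0) (by norm_num), fun i => ⟨?_, ?_⟩⟩
  · intro x hx y hy
    exact (h1 i x hx y hy).trans
      (mul_le_mul_of_nonneg_right ((hi0 i).trans (le_max_left _ _)) (aux_dnn _ _ _))
  · intro x hx y hy
    exact (h2 i x hx y hy).trans
      (mul_le_mul_of_nonneg_right ((hi0 i).trans (le_max_left _ _)) (aux_dnn _ _ _))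

/-- Contraction along words inside a forward invariant set. -/
lemma aux_contr_w (S : RDS s) {η : ℝ} (h0 : 0 < η) (W : Set EReal)
    (hW : ∀ i, ∀ x ∈ W, extE (S.f i) x ∈ W)
    (hc : ∀ i, ∀ x ∈ W, ∀ y ∈ W, S.d (extE (S.f i) x) (extE (S.f i) y) ≤ η * S.d x y)
    (w : List (Fin (s + 1))) {a b : EReal} (ha : a ∈ W) (hb : b ∈ W) :
    S.d (applyWord S w a) (applyWord S w b) ≤ η ^ w.length * S.d a b := by
  induction w generalizing a b with
  | nil => simp [applyWord]
  | cons i w ih =>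
    refine (ih (hW i a ha) (hW i b hb)).trans ?_
    rw [List.length_cons, pow_succ, mul_assoc]
    exact mul_le_mul_of_nonneg_left (hc i a ha b hb) (by positivity)

lemma aux_inv_w (S : RDS s) (W : Set EReal)
    (hW : ∀ i, ∀ x ∈ W, extE (S.f i) x ∈ W)
    (w : List (Fin (s + 1))) {a : EReal} (ha : a ∈ W) : applyWord S w a ∈ W := by
  induction w generalizing a with
  | nil => exact ha
  | cons i w ih => exact ih (hW i a ha)

/-- The image of an interval in the Fatou set stays on one side of a Julia point. -/
lemma aux_side (S : RDS s) {p : EReal} (hp : p ∈ Julia S) {x y : EReal}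
    (hF : Icc x y ⊆ (Julia S)ᶜ) (w : List (Fin (s + 1)))
    (h1 : applyWord S w x ≤ p) (h2 : p ≤ applyWord S w y) : False := by
  obtain ⟨t, ht⟩ := aux_w_surj S w p
  rw [← ht] at h1 h2
  have := aux_fwd_w S w (hF ⟨(aux_w_sm S w).le_iff_le.1 h1, (aux_w_sm S w).le_iff_le.1 h2⟩)
  rw [ht] at this
  exact this hp

/-- Locally uniform escape. -/
lemma aux_escape (S : RDS s) {p : ℝ} (hp : (p : EReal) ∈ Julia S) {A B : ℝ}
    (hA : ∀ i, ∀ x ∈ Iio (A : EReal), extE (S.f i) x ∈ Iio (A : EReal))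
    (hB : ∀ i, ∀ x ∈ Ioi (B : EReal), extE (S.f i) x ∈ Ioi (B : EReal))
    {x : EReal} (hx : x ∈ (Julia S)ᶜ) :
    ∃ U ∈ 𝓝 x, ∃ N : ℕ, ∀ z ∈ U, ∀ w : List (Fin (s + 1)), N ≤ w.length →
      applyWord S w z ∈ Iio (A : EReal) ∨ applyWord S w z ∈ Ioi (B : EReal) := by
  induction x with
  | bot => exact ⟨_, Iio_mem_nhds (EReal.bot_lt_coe A), 0,
      fun z hz w _ => Or.inl (aux_inv_w S _ hA w hz)⟩
  | top => exact ⟨_, Ioi_mem_nhds (EReal.coe_lt_top B), 0,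
      fun z hz w _ => Or.inr (aux_inv_w S _ hB w hz)⟩
  | coe x =>
    have hN := (aux_fatou_open S).mem_nhds hx
    rw [EReal.nhds_coe, mem_map] at hN
    obtain ⟨r, hr, hball⟩ := Metric.mem_nhds_iff.1 hN
    have hIcc : Icc ((x - r / 2 : ℝ) : EReal) ((x + r / 2 : ℝ) : EReal) ⊆ (Julia S)ᶜ := by
      rintro z ⟨hz1, hz2⟩
      induction z with
      | bot => exact absurd (lt_of_lt_of_le (EReal.bot_lt_coe _) hz1) (lt_irrefl _)
      | top => exact absurd (lt_of_le_of_lt hz2 (EReal.coe_lt_top _)) (lt_irrefl _)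
      | coe z =>
        have hz1 := EReal.coe_le_coe_iff.1 hz1
        have hz2 := EReal.coe_le_coe_iff.1 hz2
        apply hball
        rw [Metric.mem_ball, Real.dist_eq, abs_lt]
        constructor <;> linarith
    obtain ⟨N, hNn⟩ := pow_unbounded_of_one_lt ((|p - A| + |B - p|) / (r / 4)) S.hlam
    rw [div_lt_iff₀ (by linarith)] at hNn
    refine ⟨(fun y : ℝ => (y : EReal)) '' Metric.ball x (r / 4), ?_, N, ?_⟩
    · rw [EReal.nhds_coe]
      exact image_mem_map (Metric.ball_mem_nhds x (by linarith))
    rintro _ ⟨z, hz, rfl⟩ w hw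
    rw [Metric.mem_ball, Real.dist_eq, abs_lt] at hz
    have hpow : S.lam ^ N ≤ S.lam ^ w.length := pow_le_pow_right₀ S.hlam.le hw
    have hbig : ∀ e : ℝ, r / 4 ≤ e → |p - A| + |B - p| < S.lam ^ w.length * e := by
      intro e he
      refine hNn.trans_le (mul_le_mul hpow he (by linarith) ?_)
      exact pow_nonneg (by linarith [S.hlam]) _
    obtain ⟨a', z', ha', hz', h1⟩ := aux_w_exp S w (show x - r / 2 ≤ z by linarith)
    obtain ⟨z'', b', hz'', hb', h2⟩ := aux_w_exp S w (show z ≤ x + r / 2 by linarith)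
    have hzz : z' = z'' := EReal.coe_eq_coe_iff.1 (hz'.symm.trans hz'')
    subst hzz
    have h3 := hbig _ (show r / 4 ≤ z - (x - r / 2) by linarith)
    have h4 := hbig _ (show r / 4 ≤ x + r / 2 - z by linarith)
    have k1 := le_abs_self (p - A)
    have k2 := le_abs_self (B - p)
    have k3 := abs_nonneg (p - A)
    have k4 := abs_nonneg (B - p)
    rw [hz']
    rcases le_total a' p with hap | hap
    · left
      have hbp : b' ≤ p := by
        by_contra hc
        push Not at hc
        refine aux_side S hp hIcc w ?_ ?_
        · rw [ha']; exact EReal.coe_le_coe_iff.2 hap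
        · rw [hb']; exact EReal.coe_le_coe_iff.2 hc.le
      exact EReal.coe_lt_coe_iff.2 (by linarith)
    · right
      exact EReal.coe_lt_coe_iff.2 (by linarith)

/-- Good neighbourhoods of infinity. -/
lemma aux_AB (S : RDS s) (p : ℝ) : ∃ A B : ℝ, A < p ∧ p < B ∧
    Iio (A : EReal) ⊆ S.Vm ∧ Ioi (B : EReal) ⊆ S.Vp ∧
    (∀ i, ∀ x ∈ Iio (A : EReal), extE (S.f i) x ∈ Iio (A : EReal)) ∧
    (∀ i, ∀ x ∈ Ioi (B : EReal), extE (S.f i) x ∈ Ioi (B : EReal)) := by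
  obtain ⟨B0, hB0, h1, h2⟩ := aux_far S
  obtain ⟨B1, -, hB1⟩ := EReal.nhds_top_basis.mem_iff.1 S.hVp
  obtain ⟨A1, -, hA1⟩ := EReal.nhds_bot_basis.mem_iff.1 S.hVm
  refine ⟨min (min (-B0) A1) (p - 1), max (max B0 B1) (p + 1),
    (min_le_right _ _).trans_lt (by linarith),
    lt_of_lt_of_le (by linarith) (le_max_right _ _), ?_, ?_, ?_, ?_⟩
  · refine Subset.trans (fun x hx => ?_) hA1
    exact lt_of_lt_of_le hx
      (EReal.coe_le_coe_iff.2 ((min_le_left _ _).trans (min_le_right _ _)))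
  · refine Subset.trans (fun x hx => ?_) hB1
    exact lt_of_le_of_lt
      (EReal.coe_le_coe_iff.2 ((le_max_right _ _).trans (le_max_left _ _))) hx
  · intro i x hx
    induction x with
    | bot => rw [aux_ext_bot]; exact hx
    | top => exact absurd (mem_Iio.1 hx) not_top_lt
    | coe x =>
      rw [aux_ext_coe]
      have hx := EReal.coe_lt_coe_iff.1 hx
      have hx' : x ≤ -B0 := hx.le.trans ((min_le_left _ _).trans (min_le_left _ _))
      exact EReal.coe_lt_coe_iff.2 ((h2 i x hx').trans_lt hx)
  · intro i x hx
    induction x with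
    | top => rw [aux_ext_top]; exact hx
    | bot => exact absurd (mem_Ioi.1 hx) not_lt_bot
    | coe x =>
      rw [aux_ext_coe]
      have hx := EReal.coe_lt_coe_iff.1 hx
      have hx' : B0 ≤ x := ((le_max_left _ _).trans (le_max_left _ _)).trans hx.le
      exact EReal.coe_lt_coe_iff.2 (hx.trans_le (h1 i x hx'))

end RDS

/-- **Lemma (uniform contraction on the Fatou set, Lemma 2.11).**
There exists `η < 1` such that for every compact set `K ⊂ ℝ̄ ∖ J` there is a constant
`C_K < ∞` such that for all `x, y ∈ K` in the same connected component of `ℝ̄ ∖ J` and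
every `ω ∈ I^*`: `d(f_ω(x), f_ω(y)) ≤ C_K η^{|ω|} d(x,y)`. -/
theorem uniform_contraction_fatou {s : ℕ} (S : RDS s) :
    ∃ η : ℝ, η < 1 ∧ ∀ K : Set EReal, IsCompact K → K ⊆ (RDS.Julia S)ᶜ →
      ∃ C : ℝ, ∀ x ∈ K, ∀ y ∈ K, y ∈ connectedComponentIn (RDS.Julia S)ᶜ x →
        ∀ w : List (Fin (s + 1)), w ≠ [] →
          S.d (RDS.applyWord S w x) (RDS.applyWord S w y) ≤
            C * η ^ w.length * S.d x y := by
  obtain ⟨p, hp⟩ := RDS.aux_fix S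
  obtain ⟨A, B, hAp, hpB, hAV, hBV, hA, hB⟩ := RDS.aux_AB S p
  obtain ⟨L, hL1, hL⟩ := RDS.aux_lip S
  obtain ⟨η, h0, h1, hη⟩ := RDS.aux_eta S
  refine ⟨η, h1, fun K hK hKF => ?_⟩
  have hesc : ∃ N : ℕ, ∀ z ∈ K, ∀ w : List (Fin (s + 1)), N ≤ w.length →
      RDS.applyWord S w z ∈ Iio (A : EReal) ∨ RDS.applyWord S w z ∈ Ioi (B : EReal) := by
    refine hK.induction_on (p := fun t => ∃ N : ℕ, ∀ z ∈ t, ∀ w : List (Fin (s + 1)),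
      N ≤ w.length →
      RDS.applyWord S w z ∈ Iio (A : EReal) ∨ RDS.applyWord S w z ∈ Ioi (B : EReal)) ?_ ?_ ?_ ?_
    · exact ⟨0, by simp⟩
    · rintro a b hab ⟨D, h⟩
      exact ⟨D, fun x hx => h x (hab hx)⟩
    · rintro a b ⟨D, h⟩ ⟨D', h'⟩
      refine ⟨max D D', ?_⟩
      rintro x (hx | hx) w hw
      · exact h x hx w ((le_max_left _ _).trans hw)
      · exact h' x hx w ((le_max_right _ _).trans hw)
    · intro x hx
      obtain ⟨U, hU, N, hN⟩ := RDS.aux_escape S hp hA hB (hKF hx)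
      exact ⟨U, mem_nhdsWithin_of_mem_nhds hU, N, hN⟩
  obtain ⟨N, hN⟩ := hesc
  have hLη : 1 ≤ L / η := by rw [le_div_iff₀ h0]; linarith
  refine ⟨(L / η) ^ N, fun x hx y hy hxy w _ => ?_⟩
  have hd := RDS.aux_dnn S x y
  by_cases hw : w.length ≤ N
  · refine (RDS.aux_lip_w S hL1 hL w x y).trans (mul_le_mul_of_nonneg_right ?_ hd)
    calc L ^ w.length = (L / η) ^ w.length * η ^ w.length := by
          rw [← mul_pow, div_mul_cancel₀ _ h0.ne']
      _ ≤ (L / η) ^ N * η ^ w.length :=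
          mul_le_mul_of_nonneg_right (pow_le_pow_right₀ hLη hw) (by positivity)
  · push Not at hw
    obtain ⟨u, v, rfl, hu⟩ : ∃ u v, w = u ++ v ∧ u.length = N :=
      ⟨w.take N, w.drop N, (List.take_append_drop N w).symm, by simp [hw.le]⟩
    rw [RDS.aux_w_append, RDS.aux_w_append]
    have hxF := hKF hx
    have hoc : (connectedComponentIn (RDS.Julia S)ᶜ x).OrdConnected :=
      isPreconnected_connectedComponentIn.ordConnected
    have hxx := mem_connectedComponentIn hxF
    have hxyF : Icc x y ⊆ (RDS.Julia S)ᶜ :=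
      (hoc.out hxx hxy).trans (connectedComponentIn_subset _ _)
    have hyxF : Icc y x ⊆ (RDS.Julia S)ᶜ :=
      (hoc.out hxy hxx).trans (connectedComponentIn_subset _ _)
    have hAp' : (A : EReal) < p := EReal.coe_lt_coe_iff.2 hAp
    have hpB' : (p : EReal) < B := EReal.coe_lt_coe_iff.2 hpB
    have key : S.d (RDS.applyWord S v (RDS.applyWord S u x))
        (RDS.applyWord S v (RDS.applyWord S u y)) ≤
        η ^ v.length * S.d (RDS.applyWord S u x) (RDS.applyWord S u y) := by
      rcases hN x hx u hu.ge with ex | ex <;> rcases hN y hy u hu.ge with ey | ey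
      · exact RDS.aux_contr_w S h0 _ hA
          (fun i a ha b hb => (hη i).2 a (hAV ha) b (hAV hb)) v ex ey
      · exact (RDS.aux_side S hp hxyF u (le_of_lt (lt_trans ex hAp'))
          (le_of_lt (lt_trans hpB' ey))).elim
      · exact (RDS.aux_side S hp hyxF u (le_of_lt (lt_trans ey hAp'))
          (le_of_lt (lt_trans hpB' ex))).elim
      · exact RDS.aux_contr_w S h0 _ hB
          (fun i a ha b hb => (hη i).1 a (hBV ha) b (hBV hb)) v ex ey
    refine key.trans ?_
    have k2 := mul_le_mul_of_nonneg_left (RDS.aux_lip_w S hL1 hL u x y)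
      (pow_nonneg h0.le v.length)
    refine k2.trans (le_of_eq ?_)
    rw [List.length_append, hu, pow_add, div_pow]
    field_simp
end
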